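/- There exists a universal constant c > 0 such that every n-vertex weighted graph G = (V, E, w) (n ≥ 2) that excludes the complete graph K_r as a minor (r ≥ 2) admits a strong (c · r, c · log n)-sparse cover scheme: for every Δ > 0 there is a collection of clusters, each of strong diameter at most Δ, such that for every v ∈ V some cluster contains the ball B_G(v, Δ/(c·r)), and every vertex belongs to at most c · log n clusters. -/

import Mathlib

open MeasureTheory

namespace Pad

variable {V : Type*}

/-- The weight of a walk: the sum of the weights of its edges. -/
def walkWeight (w : Sym2 V → ℝ) {G : SimpleGraph V} {u v : V} (p : G.Walk u v) : ℝ :=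
  (p.darts.map fun d => w d.edge).sum

/-- Shortest-path distance in the weighted graph `(G, w)`. -/
noncomputable def wdist (w : Sym2 V → ℝ) (G : SimpleGraph V) (u v : V) : ℝ :=
  sInf {x | ∃ p : G.Walk u v, x = walkWeight w p}

/-- Distance from a vertex to a set of vertices. -/
noncomputable def wdistSet (w : Sym2 V → ℝ) (G : SimpleGraph V) (v : V) (A : Set V) : ℝ :=
  sInf {x | ∃ a ∈ A, x = wdist w G v a}

/-- The closed ball of radius `r` around `v`. -/
def ball (w : Sym2 V → ℝ) (G : SimpleGraph V) (v : V) (r : ℝ) : Set V :=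
  {u | wdist w G v u ≤ r}

/-- Weight of a walk of an induced subgraph, measured with the weights of `G`. -/
def walkWeightI (w : Sym2 V → ℝ) {G : SimpleGraph V} {C : Set V} {u v : C}
    (p : (G.induce C).Walk u v) : ℝ :=
  (p.darts.map fun d => w (Sym2.map Subtype.val d.edge)).sum

/-- The cluster `C` has strong diameter at most `Δ`: every two vertices of `C` are joined,
inside the induced subgraph `G[C]`, by a walk of weight at most `Δ`. -/
def StronglyBounded (w : Sym2 V → ℝ) (G : SimpleGraph V) (C : Set V) (Δ : ℝ) : Prop :=
  ∀ u v : C, ∃ p : (G.induce C).Walk u v, walkWeightI w p ≤ Δ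

/-- A partition of `V`, given by the map `cl` sending a vertex to its cluster. -/
structure Partition (V : Type*) where
  cl : V → Set V
  mem_cl : ∀ v, v ∈ cl v
  cl_eq : ∀ u v, u ∈ cl v → cl u = cl v

/-- A partition is strongly `Δ`-bounded if each of its clusters has strong diameter at most `Δ`. -/
def Partition.StronglyBounded (w : Sym2 V → ℝ) (G : SimpleGraph V) (P : Partition V)
    (Δ : ℝ) : Prop :=
  ∀ v : V, Pad.StronglyBounded w G (P.cl v) Δ

/-- `(G, w)` has doubling dimension `ddim`: every ball of radius `2r` can be covered by
`2 ^ ddim` balls of radius `r`. -/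
def Doubling (w : Sym2 V → ℝ) (G : SimpleGraph V) (ddim : ℝ) : Prop :=
  ∀ (x : V) (r : ℝ), 0 < r → ∃ T : Set V, T.Finite ∧ ((T.ncard : ℝ) ≤ (2 : ℝ) ^ ddim) ∧
    ball w G x (2 * r) ⊆ ⋃ y ∈ T, ball w G y r

/-- `G` has the complete graph `K_r` as a minor: there are `r` pairwise disjoint connected
branch sets with an edge of `G` between any two of them. -/
def HasCliqueMinor (G : SimpleGraph V) (r : ℕ) : Prop :=
  ∃ B : Fin r → Set V,
    (∀ i, (G.induce (B i)).Connected) ∧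
    (Pairwise fun i j => Disjoint (B i) (B j)) ∧
    ∀ i j : Fin r, i ≠ j → ∃ u ∈ B i, ∃ v ∈ B j, G.Adj u v

/-- A shortest path: a path whose weight equals the distance between its endpoints. -/
def IsShortestPath (w : Sym2 V → ℝ) (G : SimpleGraph V) {u v : V} (p : G.Walk u v) : Prop :=
  p.IsPath ∧ walkWeight w p = wdist w G u v

/-- `G` has an `r`-core with radius `Δ`: there are at most `r` shortest paths such that every
vertex is within distance `Δ` of their union. -/
def HasCore (w : Sym2 V → ℝ) (G : SimpleGraph V) (r : ℕ) (Δ : ℝ) : Prop :=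
  ∃ r' : ℕ, r' ≤ r ∧ ∃ (a b : Fin r' → V) (p : ∀ i, G.Walk (a i) (b i)),
    (∀ i, IsShortestPath w G (p i)) ∧
    ∀ v : V, ∃ i, ∃ u ∈ (p i).support, wdist w G v u ≤ Δ

end Pad

namespace Pad

section Walks

variable {V : Type*} {w : Sym2 V → ℝ} {G : SimpleGraph V}

theorem walkWeight_nil (u : V) : walkWeight w (SimpleGraph.Walk.nil : G.Walk u u) = 0 := by
  simp [walkWeight]

theorem walkWeight_cons {u v x : V} (h : G.Adj u v) (p : G.Walk v x) :
    walkWeight w (SimpleGraph.Walk.cons h p) = w s(u, v) + walkWeight w p := by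
  simp [walkWeight, SimpleGraph.Dart.edge]

theorem walkWeight_append {u v x : V} (p : G.Walk u v) (q : G.Walk v x) :
    walkWeight w (p.append q) = walkWeight w p + walkWeight w q := by
  simp [walkWeight]

theorem walkWeight_reverse {u v : V} (p : G.Walk u v) :
    walkWeight w p.reverse = walkWeight w p := by
  simp only [walkWeight, SimpleGraph.Walk.darts_reverse, List.map_reverse, List.map_map,
    List.sum_reverse]
  congr 1
  apply List.map_congr_left
  intro d _
  simp

theorem walkWeight_nonneg (hw : ∀ e, 0 ≤ w e) {u v : V} (p : G.Walk u v) :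
    0 ≤ walkWeight w p := by
  apply List.sum_nonneg
  simp only [List.mem_map]
  rintro x ⟨d, _, rfl⟩
  exact hw _

theorem walkWeight_bypass_le [DecidableEq V] (hw : ∀ e, 0 ≤ w e) {u v : V} (p : G.Walk u v) :
    walkWeight w p.bypass ≤ walkWeight w p := by
  apply List.Sublist.sum_le_sum ((SimpleGraph.Walk.darts_bypass_sublist_darts p).map _)
  simp only [List.mem_map]
  rintro x ⟨d, _, rfl⟩
  exact hw _

/-- `v` can be reached from `u` by a walk inside `A` of weight at most `L`. -/
def Reach (w : Sym2 V → ℝ) (G : SimpleGraph V) (A : Set V) (L : ℝ) (u v : V) : Prop :=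
  ∃ p : G.Walk u v, (∀ x ∈ p.support, x ∈ A) ∧ walkWeight w p ≤ L

variable {A B : Set V} {L L' : ℝ} {u v x : V}

theorem Reach.refl (hu : u ∈ A) (hL : 0 ≤ L) : Reach w G A L u u :=
  ⟨.nil, by simpa using hu, by simpa [walkWeight_nil] using hL⟩

theorem Reach.mono (h : Reach w G A L u v) (hA : A ⊆ B) (hL : L ≤ L') : Reach w G B L' u v := by
  obtain ⟨p, hp, hp'⟩ := h
  exact ⟨p, fun x hx => hA (hp x hx), hp'.trans hL⟩

theorem Reach.symm (h : Reach w G A L u v) : Reach w G A L v u := by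
  obtain ⟨p, hp, hp'⟩ := h
  exact ⟨p.reverse, by simpa using hp, by rwa [walkWeight_reverse]⟩

theorem Reach.trans (h : Reach w G A L u v) (h' : Reach w G A L' v x) :
    Reach w G A (L + L') u x := by
  obtain ⟨p, hp, hp'⟩ := h
  obtain ⟨q, hq, hq'⟩ := h'
  refine ⟨p.append q, ?_, ?_⟩
  · intro y hy
    rcases (SimpleGraph.Walk.mem_support_append_iff _ _).1 hy with h | h
    exacts [hp y h, hq y h]
  · rw [walkWeight_append]; linarith

theorem Reach.left_mem (h : Reach w G A L u v) : u ∈ A := by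
  obtain ⟨p, hp, _⟩ := h
  exact hp _ p.start_mem_support

theorem Reach.right_mem (h : Reach w G A L u v) : v ∈ A := by
  obtain ⟨p, hp, _⟩ := h
  exact hp _ p.end_mem_support

theorem Reach.nonneg (hw : ∀ e, 0 ≤ w e) (h : Reach w G A L u v) : 0 ≤ L := by
  obtain ⟨p, _, hp⟩ := h
  exact (walkWeight_nonneg hw p).trans hp

theorem exists_reach_of_mem_support {p : G.Walk u v} (hp : ∀ y ∈ p.support, y ∈ A)
    (hx : x ∈ p.support) :
    ∃ a b, a + b = walkWeight w p ∧ Reach w G A a u x ∧ Reach w G A b x v := by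
  classical
  refine ⟨walkWeight w (p.takeUntil x hx), walkWeight w (p.dropUntil x hx), ?_,
    ⟨_, fun y hy => hp y (p.support_takeUntil_subset_support hx hy), le_rfl⟩,
    ⟨_, fun y hy => hp y (p.support_dropUntil_subset_support hx hy), le_rfl⟩⟩
  rw [← walkWeight_append, SimpleGraph.Walk.take_spec]

/-- A walk entering a set splits at the last vertex before its first entrance. -/
theorem exists_first_entrance {Y : Set V} (p : G.Walk u v)
    (hp : ∀ y ∈ p.support, y ∈ A) (hu : u ∉ Y) (hv : v ∈ Y) :
    ∃ x y, G.Adj x y ∧ y ∈ Y ∧ ∃ a b, a + b ≤ walkWeight w p ∧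
      Reach w G (A \ Y) a u x ∧ Reach w G A b x v := by
  induction p with
  | nil => exact absurd hv hu
  | @cons u z v h p ih =>
    have huA : u ∈ A := hp u (by simp)
    have hp' : ∀ y ∈ p.support, y ∈ A := fun y hy => hp y (by simp [hy])
    by_cases hz : z ∈ Y
    · exact ⟨u, z, h, hz, 0, walkWeight w (SimpleGraph.Walk.cons h p), by simp,
        Reach.refl ⟨huA, hu⟩ le_rfl, ⟨_, hp, le_rfl⟩⟩
    · obtain ⟨x, y, hxy, hy, a, b, hab, ha, hb⟩ := ih hp' hz hv
      refine ⟨x, y, hxy, hy, w s(u, z) + a, b, ?_, ?_, hb⟩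
      · rw [walkWeight_cons]; linarith
      · have : Reach w G (A \ Y) (w s(u, z)) u z := by
          refine ⟨.cons h .nil, ?_, by simp [walkWeight_cons, walkWeight_nil]⟩
          intro y hy
          simp at hy
          rcases hy with rfl | rfl
          exacts [⟨huA, hu⟩, ha.left_mem]
        exact this.trans ha

/-- Among the walks inside a set between two vertices there is a lightest one. -/
theorem exists_min_walk [Finite V] (hw : ∀ e, 0 ≤ w e) (h : Reach w G A L u v) :
    ∃ p : G.Walk u v, (∀ x ∈ p.support, x ∈ A) ∧
      ∀ L', Reach w G A L' u v → walkWeight w p ≤ L' := by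
  have := Fintype.ofFinite V
  classical
  have key : ∀ p : G.Walk u v, (∀ x ∈ p.support, x ∈ A) →
      ∃ q : G.Path u v, (∀ x ∈ (q : G.Walk u v).support, x ∈ A) ∧
        walkWeight w (q : G.Walk u v) ≤ walkWeight w p := fun p hp =>
    ⟨⟨p.bypass, p.bypass_isPath⟩, fun x hx => hp x (p.support_bypass_subset_support hx),
      walkWeight_bypass_le hw p⟩
  obtain ⟨p₀, hp₀, _⟩ := h
  obtain ⟨q₀, hq₀, _⟩ := key p₀ hp₀
  obtain ⟨q, hq, hmin⟩ := Finset.exists_min_image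
    (Finset.univ.filter fun q : G.Path u v => ∀ x ∈ (q : G.Walk u v).support, x ∈ A)
    (fun q => walkWeight w (q : G.Walk u v)) ⟨q₀, by simpa using hq₀⟩
  refine ⟨q, by simpa using hq, ?_⟩
  rintro L' ⟨p, hp, hpL⟩
  obtain ⟨q', hq', hle⟩ := key p hp
  exact (hmin q' (by simpa using hq')).trans (hle.trans hpL)

/-- Distance inside the induced subgraph on `A` (meaningful when the two vertices are joined by
a walk inside `A`). -/
noncomputable def distIn (w : Sym2 V → ℝ) (G : SimpleGraph V) (A : Set V) (u v : V) : ℝ :=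
  sInf {L | Reach w G A L u v}

theorem distIn_le (hw : ∀ e, 0 ≤ w e) (h : Reach w G A L u v) : distIn w G A u v ≤ L :=
  csInf_le ⟨0, fun _ h => Reach.nonneg hw h⟩ h

theorem le_distIn (h : Reach w G A L u v) {b : ℝ} (hb : ∀ L', Reach w G A L' u v → b ≤ L') :
    b ≤ distIn w G A u v :=
  le_csInf ⟨L, h⟩ hb

theorem reach_distIn [Finite V] (hw : ∀ e, 0 ≤ w e) (h : Reach w G A L u v) :
    Reach w G A (distIn w G A u v) u v := by
  obtain ⟨p, hp, hmin⟩ := exists_min_walk hw h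
  exact ⟨p, hp, le_distIn h hmin⟩

/-- `A` is nonempty and its induced subgraph is connected. -/
def ConnIn (w : Sym2 V → ℝ) (G : SimpleGraph V) (A : Set V) : Prop :=
  A.Nonempty ∧ ∀ u ∈ A, ∀ v ∈ A, ∃ L, Reach w G A L u v

theorem induce_connected_of_connIn (h : ConnIn w G A) : (G.induce A).Connected := by
  have : Nonempty A := h.1.to_subtype
  refine ⟨?_⟩
  rintro ⟨u, hu⟩ ⟨v, hv⟩
  obtain ⟨L, p, hp, _⟩ := h.2 u hu v hv
  exact ⟨p.induce A hp⟩

theorem walkWeightI_eq_map {u v : A} (p : (G.induce A).Walk u v) :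
    walkWeightI w p = walkWeight w (p.map (SimpleGraph.Embedding.induce A).toHom) := by
  induction p with
  | nil => simp [walkWeightI, walkWeight]
  | cons h p ih =>
    rw [SimpleGraph.Walk.map_cons, walkWeight_cons, ← ih]
    simp [walkWeightI, SimpleGraph.Dart.edge]

theorem stronglyBounded_of_reach (h : ∀ u ∈ A, ∀ v ∈ A, Reach w G A L u v) :
    StronglyBounded w G A L := by
  rintro ⟨u, hu⟩ ⟨v, hv⟩
  obtain ⟨p, hp, hL⟩ := h u hu v hv
  refine ⟨p.induce A hp, ?_⟩
  rw [walkWeightI_eq_map, SimpleGraph.Walk.map_induce]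
  exact hL

/-- The ball of radius `ρ` around `z` is contained in `A`. -/
def Padded (w : Sym2 V → ℝ) (G : SimpleGraph V) (ρ : ℝ) (z : V) (A : Set V) : Prop :=
  ∀ u, Reach w G Set.univ ρ z u → u ∈ A

variable {ρ : ℝ} {z : V}

theorem Padded.mem (hρ : 0 ≤ ρ) (h : Padded w G ρ z A) : z ∈ A :=
  h z (Reach.refl trivial hρ)

theorem Padded.reach (hw : ∀ e, 0 ≤ w e) (h : Padded w G ρ z A)
    (hu : Reach w G Set.univ ρ z u) : Reach w G A ρ z u := by
  obtain ⟨p, hp, hL⟩ := hu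
  refine ⟨p, fun x hx => h x ?_, hL⟩
  obtain ⟨a, b, hab, ha, hb⟩ := exists_reach_of_mem_support (w := w) hp hx
  exact ha.mono subset_rfl (by linarith [hb.nonneg hw])

theorem Padded.ball_subset [Finite V] (hw : ∀ e, 0 ≤ w e) (hG : G.Connected)
    (h : Padded w G ρ z A) : ball w G z ρ ⊆ A := by
  intro u hu
  apply h
  obtain ⟨p⟩ := hG.preconnected z u
  have hp : Reach w G Set.univ (walkWeight w p) z u := ⟨p, fun _ _ => trivial, le_rfl⟩
  obtain ⟨q, hq, hmin⟩ := exists_min_walk hw hp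
  refine ⟨q, hq, le_trans ?_ hu⟩
  refine le_csInf ⟨_, p, rfl⟩ ?_
  rintro _ ⟨p', rfl⟩
  exact hmin _ ⟨p', fun _ _ => trivial, le_rfl⟩

end Walks

section Shifts

/-- The truncated geometric variable on the uniform space `Fin (2 ^ M)`. -/
def geomLevel {M : ℕ} (b : Fin (2 ^ M)) : ℕ := M - Nat.size b

theorem geomLevel_le {M : ℕ} (b : Fin (2 ^ M)) : geomLevel b ≤ M := Nat.sub_le _ _

/-- The half of an element of `Fin (2 ^ M)`. -/
def finHalf {M : ℕ} (b : Fin (2 ^ M)) : Fin (2 ^ M) := ⟨b / 2, (Nat.div_le_self _ _).trans_lt b.2⟩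

theorem geomLevel_finHalf {M : ℕ} {b : Fin (2 ^ M)} (hb : (b : ℕ) ≠ 0) :
    geomLevel (finHalf b) = geomLevel b + 1 := by
  have h1 : Nat.size b ≤ M := Nat.size_le.2 b.2
  have h2 : Nat.size b = Nat.size (b / 2) + 1 := by
    have hlt : ∀ n, Nat.size (b / 2) ≤ n ↔ Nat.size b ≤ n + 1 := by
      intro n
      rw [Nat.size_le, Nat.size_le, pow_succ]
      omega
    have h3 := (hlt (Nat.size (b / 2))).1 le_rfl
    have h4 : 0 < Nat.size b := Nat.size_pos.2 (Nat.pos_of_ne_zero hb)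
    have h5 := (hlt (Nat.size b - 1)).2 (by omega)
    omega
  simp only [geomLevel, finHalf]
  omega

variable {N : Type*} {M : ℕ} {δ ρ : ℝ} {a : N → ℝ}

/-- The shifted proximity of a vertex at distance `a t` from the centre `t`. -/
noncomputable def shifted (δ : ℝ) (a : N → ℝ) (f : N → Fin (2 ^ M)) (t : N) : ℝ :=
  geomLevel (f t) * δ - a t

theorem card_filter_eq_zero_mul_le [Fintype N] [DecidableEq N] (t : N) :
    (Finset.univ.filter fun f : N → Fin (2 ^ M) => (f t : ℕ) = 0).card * 2 ^ M ≤
      Fintype.card (N → Fin (2 ^ M)) := by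
  have : (Finset.univ.filter fun f : N → Fin (2 ^ M) => (f t : ℕ) = 0).card * 2 ^ M =
      (Finset.univ.filter fun f : N → Fin (2 ^ M) => (f t : ℕ) = 0).card *
        (Finset.univ : Finset (Fin (2 ^ M))).card := by simp
  rw [this, ← Finset.card_product, ← Finset.card_univ]
  apply Finset.card_le_card_of_injOn (fun p => Function.update p.1 t p.2)
  · intro _ _; simp
  · rintro ⟨f, b⟩ hf ⟨g, c⟩ hg h
    simp only [Finset.coe_product, Finset.coe_filter, Finset.mem_univ, true_and, Set.mem_prod,
      Set.mem_ofPred_eq] at hf hg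
    have hbc : b = c := by simpa using congrFun h t
    refine Prod.ext (funext fun s => ?_) hbc
    by_cases hs : s = t
    · subst hs; exact Fin.ext (by simp [hf.1, hg.1])
    · simpa [hs] using congrFun h s

/-- One centre beats all the other ones by a margin of more than `2 * ρ`. -/
def HasMargin (δ ρ : ℝ) (a : N → ℝ) (f : N → Fin (2 ^ M)) : Prop :=
  ∃ t, ∀ t', t' ≠ t → shifted δ a f t' + 2 * ρ < shifted δ a f t

open scoped Classical in
theorem card_top_le [Fintype N] [DecidableEq N] (hδ : 2 * ρ < δ) (t : N) :
    (Finset.univ.filter fun f : N → Fin (2 ^ M) =>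
        ∀ t', shifted δ a f t' ≤ shifted δ a f t).card ≤
      (Finset.univ.filter fun f : N → Fin (2 ^ M) => (f t : ℕ) = 0).card +
      2 * (Finset.univ.filter fun f : N → Fin (2 ^ M) =>
        ∀ t', t' ≠ t → shifted δ a f t' + 2 * ρ < shifted δ a f t).card := by
  set P := Finset.univ.filter fun f : N → Fin (2 ^ M) =>
        ∀ t', shifted δ a f t' ≤ shifted δ a f t with hP
  have hsplit : P ⊆ (Finset.univ.filter fun f : N → Fin (2 ^ M) => (f t : ℕ) = 0) ∪
      P.filter fun f => (f t : ℕ) ≠ 0 := by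
    intro f hf
    by_cases h0 : (f t : ℕ) = 0
    · exact Finset.mem_union_left _ (Finset.mem_filter.2 ⟨Finset.mem_univ _, h0⟩)
    · exact Finset.mem_union_right _ (Finset.mem_filter.2 ⟨hf, h0⟩)
  refine (Finset.card_le_card hsplit).trans ((Finset.card_union_le _ _).trans ?_)
  gcongr
  refine Finset.card_le_mul_card_image_of_maps_to
    (f := fun f => Function.update f t (finHalf (f t))) ?_ 2 ?_
  · intro f hf
    obtain ⟨hf, h0⟩ := Finset.mem_filter.1 hf
    simp only [hP, Finset.mem_filter, Finset.mem_univ, true_and] at hf ⊢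
    intro t' ht'
    have h1 := hf t'
    simp only [shifted, Function.update_self, Function.update_of_ne ht',
      geomLevel_finHalf h0] at h1 ⊢
    push_cast
    linarith
  · intro g _
    have : ∀ f ∈ (P.filter fun f => (f t : ℕ) ≠ 0).filter
        (fun f => Function.update f t (finHalf (f t)) = g),
        (f t : ℕ) ∈ ({2 * (g t : ℕ), 2 * (g t : ℕ) + 1} : Finset ℕ) := by
      intro f hf
      obtain ⟨_, hf⟩ := Finset.mem_filter.1 hf
      have := congrArg (fun b : Fin (2 ^ M) => (b : ℕ)) (congrFun hf t)
      simp only [Function.update_self, finHalf] at this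
      simp only [Finset.mem_insert, Finset.mem_singleton]
      omega
    refine (Finset.card_le_card_of_injOn (fun f => (f t : ℕ))
      (fun f hf => this f hf) ?_).trans Finset.card_le_two
    intro f hf f' hf' h
    have hf := (Finset.mem_filter.1 hf).2
    have hf' := (Finset.mem_filter.1 hf').2
    funext s
    by_cases hs : s = t
    · subst hs; exact Fin.ext h
    · have h1 := congrFun hf s
      have h2 := congrFun hf' s
      simp only [Function.update_of_ne hs] at h1 h2
      rw [h1, h2]

open scoped Classical in
/-- With geometric shifts, at least a quarter of all shift vectors give the vertex a centre which
beats all the other ones by a margin. -/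
theorem card_le_four_mul_card_margin [Fintype N] [DecidableEq N] [Nonempty N] (hρ : 0 ≤ ρ) (hδ : 2 * ρ < δ)
    (R : Finset N) (hR : 2 * R.card ≤ 2 ^ M) (hrel : ∀ t ∉ R, ∃ t', a t' + M * δ < a t) :
    Fintype.card (N → Fin (2 ^ M)) ≤
      4 * (Finset.univ.filter fun f : N → Fin (2 ^ M) => HasMargin δ ρ a f).card := by
  set Ω := Fintype.card (N → Fin (2 ^ M)) with hΩ
  set ok : N → Finset (N → Fin (2 ^ M)) := fun t => Finset.univ.filter fun f =>
    ∀ t', t' ≠ t → shifted δ a f t' + 2 * ρ < shifted δ a f t with hok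
  set top : N → Finset (N → Fin (2 ^ M)) := fun t => Finset.univ.filter fun f =>
    ∀ t', shifted δ a f t' ≤ shifted δ a f t with htop
  have hδ0 : 0 < δ := by linarith
  have htop_mem : ∀ t f, f ∈ top t → t ∈ R := by
    intro t f hf
    by_contra ht
    obtain ⟨t', ht'⟩ := hrel t ht
    have h1 := (Finset.mem_filter.1 hf).2 t'
    have h2 : (geomLevel (f t) : ℝ) * δ ≤ M * δ := by
      gcongr; exact geomLevel_le _
    have h3 : 0 ≤ (geomLevel (f t') : ℝ) * δ := by positivity
    simp only [shifted] at h1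
    linarith
  have hcover : Ω ≤ ∑ t ∈ R, (top t).card := by
    rw [hΩ, ← Finset.card_univ]
    refine (Finset.card_le_card ?_).trans Finset.card_biUnion_le
    intro f _
    obtain ⟨t, ht⟩ := Finite.exists_max (shifted δ a f)
    have : f ∈ top t := Finset.mem_filter.2 ⟨Finset.mem_univ _, ht⟩
    exact Finset.mem_biUnion.2 ⟨t, htop_mem t f this, this⟩
  have hsum : ∑ t ∈ R, (ok t).card ≤ (Finset.univ.filter fun f : N → Fin (2 ^ M) => HasMargin δ ρ a f).card := by
    rw [← Finset.card_biUnion]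
    · apply Finset.card_le_card
      intro f hf
      obtain ⟨t, _, ht⟩ := Finset.mem_biUnion.1 hf
      exact Finset.mem_filter.2 ⟨Finset.mem_univ _, t, (Finset.mem_filter.1 ht).2⟩
    · intro t _ s _ hts
      rw [Function.onFun, Finset.disjoint_left]
      intro f h1 h2
      have h1 := (Finset.mem_filter.1 h1).2 s hts.symm
      have h2 := (Finset.mem_filter.1 h2).2 t hts
      linarith
  obtain ⟨t₀⟩ := ‹Nonempty N›
  set Z := (2 ^ M) ^ (Fintype.card N - 1) with hZ
  have hz : ∀ t, (Finset.univ.filter fun f : N → Fin (2 ^ M) => (f t : ℕ) = 0).card ≤ Z := by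
    intro t
    have h := card_filter_eq_zero_mul_le (M := M) t
    have hpos : 0 < 2 ^ M := by positivity
    have hN : Fintype.card N = Fintype.card N - 1 + 1 := by
      have : 0 < Fintype.card N := Fintype.card_pos_iff.2 ⟨t⟩
      omega
    rw [Fintype.card_fun, Fintype.card_fin, hN, pow_succ] at h
    exact Nat.le_of_mul_le_mul_right h hpos
  have hΩZ : Ω = Z * 2 ^ M := by
    have hN : Fintype.card N = Fintype.card N - 1 + 1 := by
      have : 0 < Fintype.card N := Fintype.card_pos_iff.2 ⟨t₀⟩
      omega
    rw [hΩ, Fintype.card_fun, Fintype.card_fin, hN, pow_succ]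
  have hbound : ∑ t ∈ R, (top t).card ≤ R.card * Z + 2 * ∑ t ∈ R, (ok t).card := by
    rw [Finset.mul_sum, ← smul_eq_mul, ← Finset.sum_const, ← Finset.sum_add_distrib]
    exact Finset.sum_le_sum fun t _ => (card_top_le hδ t).trans (Nat.add_le_add_right (hz t) _)
  have h2 : 2 * R.card * Z ≤ 2 ^ M * Z := Nat.mul_le_mul_right _ hR
  nlinarith

end Shifts

section Families

variable {V : Type*} {w : Sym2 V → ℝ} {G : SimpleGraph V}
variable {A C Y : Set V} {L L' ρ δ Δ : ℝ} {u v z : V} {S : Finset V} {q : ℝ}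

/-- There are pairwise disjoint clusters inside `C`, of strong diameter at most `Δ`, padding at
least `q` of the vertices in `S`. -/
def HasPaddedFamily (w : Sym2 V → ℝ) (G : SimpleGraph V) (ρ Δ : ℝ) (C : Set V) (S : Finset V)
    (q : ℝ) : Prop :=
  ∃ F : Set (Set V), (∀ A ∈ F, A ⊆ C ∧ StronglyBounded w G A Δ) ∧ F.PairwiseDisjoint id ∧
    ∃ S' ⊆ S, (∀ z ∈ S', ∃ A ∈ F, Padded w G ρ z A) ∧ q ≤ S'.card

theorem HasPaddedFamily.mono {q' : ℝ} (h : HasPaddedFamily w G ρ Δ C S q) (hq : q' ≤ q) :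
    HasPaddedFamily w G ρ Δ C S q' := by
  obtain ⟨F, hF, hd, S', hS', hp, hc⟩ := h
  exact ⟨F, hF, hd, S', hS', hp, hq.trans hc⟩

theorem HasPaddedFamily.biUnion {ι : Type*} (hρ : 0 ≤ ρ) (I : Finset ι) {P : ι → Set V}
    {T : ι → Finset V} {q : ι → ℝ} (hdisj : (I : Set ι).PairwiseDisjoint P)
    (hP : ∀ i ∈ I, P i ⊆ C) (hT : ∀ i ∈ I, T i ⊆ S)
    (h : ∀ i ∈ I, HasPaddedFamily w G ρ Δ (P i) (T i) (q i)) :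
    HasPaddedFamily w G ρ Δ C S (∑ i ∈ I, q i) := by
  classical
  have h' : ∀ i, ∃ F : Set (Set V), ∃ S' : Finset V, i ∈ I →
      ((∀ A ∈ F, A ⊆ P i ∧ StronglyBounded w G A Δ) ∧ F.PairwiseDisjoint id ∧
      S' ⊆ T i ∧ (∀ z ∈ S', ∃ A ∈ F, Padded w G ρ z A) ∧ q i ≤ S'.card) := by
    intro i
    by_cases hi : i ∈ I
    · obtain ⟨F, hF, hd, S', hS', hp, hc⟩ := h i hi
      exact ⟨F, S', fun _ => ⟨hF, hd, hS', hp, hc⟩⟩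
    · exact ⟨∅, ∅, fun hi' => absurd hi' hi⟩
  choose F S' hFS using h'
  refine ⟨⋃ i ∈ I, F i, ?_, ?_, I.biUnion S', ?_, ?_, ?_⟩
  · intro A hA
    simp only [Set.mem_iUnion] at hA
    obtain ⟨i, hi, hA⟩ := hA
    exact ⟨((hFS i hi).1 A hA).1.trans (hP i hi), ((hFS i hi).1 A hA).2⟩
  · intro A hA B hB hAB
    simp only [Set.mem_iUnion] at hA hB
    obtain ⟨i, hi, hA⟩ := hA
    obtain ⟨j, hj, hB⟩ := hB
    by_cases hij : i = j
    · subst hij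
      exact (hFS i hi).2.1 hA hB hAB
    · exact (hdisj hi hj hij).mono ((hFS i hi).1 A hA).1 ((hFS j hj).1 B hB).1
  · exact Finset.biUnion_subset.2 fun i hi => (hFS i hi).2.2.1.trans (hT i hi)
  · intro z hz
    obtain ⟨i, hi, hz⟩ := Finset.mem_biUnion.1 hz
    obtain ⟨A, hA, hzA⟩ := (hFS i hi).2.2.2.1 z hz
    exact ⟨A, Set.mem_biUnion hi hA, hzA⟩
  · rw [Finset.card_biUnion]
    · push_cast
      exact Finset.sum_le_sum fun i hi => (hFS i hi).2.2.2.2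
    · intro i hi j hj hij
      rw [Function.onFun, Finset.disjoint_left]
      intro z hz hz'
      obtain ⟨A, hA, hzA⟩ := (hFS i hi).2.2.2.1 z hz
      obtain ⟨B, hB, hzB⟩ := (hFS j hj).2.2.2.1 z hz'
      exact Set.disjoint_left.1 (hdisj hi hj hij) (((hFS i hi).1 A hA).1 (hzA.mem hρ))
        (((hFS j hj).1 B hB).1 (hzB.mem hρ))

theorem exists_net [Finite V] (hL : 0 ≤ L) {T : Set V} (hT : T ⊆ Y) :
    ∃ N ⊆ T, (∀ t ∈ N, ∀ t' ∈ N, Reach w G Y L t t' → t = t') ∧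
      ∀ t ∈ T, ∃ s ∈ N, Reach w G Y L t s := by
  obtain ⟨N, hN⟩ := (Set.toFinite {N : Set V | N ⊆ T ∧
    ∀ t ∈ N, ∀ t' ∈ N, Reach w G Y L t t' → t = t'}).exists_maximal ⟨∅, by simp⟩
  refine ⟨N, hN.prop.1, hN.prop.2, fun t ht => ?_⟩
  by_contra! hcon
  have hmem : insert t N ∈ {N : Set V | N ⊆ T ∧
      ∀ t ∈ N, ∀ t' ∈ N, Reach w G Y L t t' → t = t'} := by
    refine ⟨Set.insert_subset ht hN.prop.1, ?_⟩
    rintro s (rfl | hs) s' (rfl | hs') h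
    · rfl
    · exact absurd h (hcon s' hs')
    · exact absurd h.symm (hcon s hs)
    · exact hN.prop.2 s hs s' hs' h
  exact hcon t (hN.le_of_ge hmem (Set.subset_insert _ _) (Set.mem_insert _ _))
    (Reach.refl (hT ht) hL)

theorem card_near_le (hL : 0 < L) (𝒬 : Finset (Set V)) {c : V → ℝ}
    (hc : ∀ u v L', Reach w G Y L' u v → |c u - c v| ≤ L')
    (h𝒬 : ∀ Q ∈ 𝒬, ∀ u ∈ Q, ∀ u' ∈ Q, Reach w G Y |c u - c u'| u u')
    {R : Finset V} (hR : ∀ t ∈ R, ∃ Q ∈ 𝒬, t ∈ Q)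
    (hsep : ∀ t ∈ R, ∀ t' ∈ R, Reach w G Y L t t' → t = t')
    (hnear : ∀ t ∈ R, Reach w G Y (3 * L) z t) : R.card ≤ 𝒬.card * 7 := by
  classical
  choose! Q hQ htQ using hR
  have h7 : (Finset.Icc (⌊c z / L⌋ - 3) (⌊c z / L⌋ + 3)).card = 7 := by
    rw [Int.card_Icc]; omega
  rw [← h7, ← Finset.card_product]
  apply Finset.card_le_card_of_injOn (fun t => (Q t, ⌊c t / L⌋))
  · intro t ht
    have h := abs_le.1 (hc _ _ _ (hnear t ht))
    refine Finset.mem_coe.2 (Finset.mem_product.2 ⟨hQ t ht, Finset.mem_Icc.2 ⟨?_, ?_⟩⟩)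
    · rw [Int.le_floor, le_div_iff₀ hL]
      have := (le_div_iff₀ hL).1 (Int.floor_le (c z / L))
      push_cast
      linarith [h.2]
    · rw [← Int.floor_add_ofNat]
      refine Int.floor_mono ?_
      rw [div_add' _ _ _ hL.ne', div_le_div_iff_of_pos_right hL]
      linarith [h.1]
  · intro t ht t' ht' h
    simp only [Prod.mk.injEq] at h
    have h1 := h𝒬 _ (hQ t ht) t (htQ t ht) t' (h.1 ▸ htQ t' ht')
    refine hsep t ht t' ht' (h1.mono subset_rfl ?_)
    have h2 := Int.abs_sub_lt_one_of_floor_eq_floor h.2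
    rw [← sub_div, abs_div, abs_of_pos hL, div_lt_one hL] at h2
    exact h2.le

theorem distIn_le_add [Finite V] (hw : ∀ e, 0 ≤ w e) {t : V} (h : Reach w G Y L z u)
    (h' : Reach w G Y L' u t) : distIn w G Y z t ≤ L + distIn w G Y u t :=
  distIn_le hw (h.trans (reach_distIn hw h'))

/-- A region dominated by few geodesics can be split into disjoint clusters padding a quarter of
the given vertices. -/
theorem hasPaddedFamily_of_dominated [Finite V] (hw : ∀ e, 0 ≤ w e) (hρ : 0 ≤ ρ)
    (hδ : 2 * ρ < δ) {M : ℕ} (hM : 0 < M) (hY : ConnIn w G Y) (𝒬 : Finset (Set V))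
    (hcard : 14 * 𝒬.card ≤ 2 ^ M) (h𝒬Y : ∀ Q ∈ 𝒬, Q ⊆ Y) {c : V → ℝ}
    (hc : ∀ u v L', Reach w G Y L' u v → |c u - c v| ≤ L')
    (h𝒬 : ∀ Q ∈ 𝒬, ∀ u ∈ Q, ∀ u' ∈ Q, Reach w G Y |c u - c u'| u u')
    (hdom : ∀ y ∈ Y, ∃ Q ∈ 𝒬, ∃ t ∈ Q, Reach w G Y (M * δ) y t)
    (hS : ∀ z ∈ S, Padded w G ρ z Y) :
    HasPaddedFamily w G ρ (6 * (M * δ)) Y S (S.card / 4) := by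
  classical
  have hδ0 : 0 < δ := by linarith
  have hL : 0 < M * δ := by positivity
  obtain ⟨N, hNT, hsep, hnet⟩ := exists_net (w := w) (G := G) (Y := Y) (L := M * δ) hL.le
    (T := {t | ∃ Q ∈ 𝒬, t ∈ Q}) (by rintro t ⟨Q, hQ, ht⟩; exact h𝒬Y Q hQ ht)
  have hNY : ∀ t : N, (t : V) ∈ Y := by
    intro t
    obtain ⟨Q, hQ, ht⟩ := hNT t.2
    exact h𝒬Y Q hQ ht
  have hclose : ∀ y ∈ Y, ∃ t : N, distIn w G Y y t ≤ 2 * (M * δ) := by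
    intro y hy
    obtain ⟨Q, hQ, t, ht, hyt⟩ := hdom y hy
    obtain ⟨s, hs, hts⟩ := hnet t ⟨Q, hQ, ht⟩
    refine ⟨⟨s, hs⟩, distIn_le hw ?_⟩
    convert hyt.trans hts using 1
    ring
  have hreach : ∀ y ∈ Y, ∀ t : N, Reach w G Y (distIn w G Y y t) y t := fun y hy t =>
    reach_distIn hw (hY.2 y hy t (hNY t)).choose_spec
  have : Fintype N := Fintype.ofFinite _
  have : Nonempty N := ⟨(hclose _ hY.1.some_mem).choose⟩
  let a : V → N → ℝ := fun z t => distIn w G Y z t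
  have htri : ∀ {x y : V} {l : ℝ}, Reach w G Y l x y → ∀ t, a x t ≤ l + a y t :=
    fun h t => distIn_le_add hw h (hreach _ h.right_mem t)
  have hgood : ∀ z ∈ S, Fintype.card (N → Fin (2 ^ M)) ≤
      4 * (Finset.univ.filter fun f : N → Fin (2 ^ M) => HasMargin δ ρ (a z) f).card := by
    intro z hz
    have hzY := (hS z hz).mem hρ
    refine card_le_four_mul_card_margin hρ hδ
      (Finset.univ.filter fun t => a z t ≤ 3 * (M * δ)) ?_ ?_
    · refine le_trans ?_ hcard
      have := card_near_le (w := w) (G := G) (Y := Y) (z := z) hL 𝒬 hc h𝒬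
        (R := (Finset.univ.filter fun t => a z t ≤ 3 * (M * δ)).map
          (Function.Embedding.subtype _)) ?_ ?_ ?_
      · rw [Finset.card_map] at this
        omega
      · simp only [Finset.mem_map]
        rintro _ ⟨t, _, rfl⟩
        exact hNT t.2
      · simp only [Finset.mem_map]
        rintro _ ⟨t, _, rfl⟩ _ ⟨t', _, rfl⟩ h
        exact hsep _ t.2 _ t'.2 h
      · simp only [Finset.mem_map]
        rintro _ ⟨t, ht, rfl⟩
        exact (hreach z hzY t).mono subset_rfl (Finset.mem_filter.1 ht).2
    · intro t ht
      obtain ⟨t', ht'⟩ := hclose z hzY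
      refine ⟨t', ?_⟩
      have : 3 * (M * δ) < a z t := by simpa using ht
      have : a z t' ≤ 2 * (M * δ) := ht'
      linarith
  obtain ⟨f, hf⟩ : ∃ f, S.card ≤ 4 * (S.filter fun z => HasMargin δ ρ (a z) f).card := by
    have h1 := Finset.sum_le_sum hgood
    rw [← Finset.mul_sum, Finset.sum_const, smul_eq_mul] at h1
    have h2 := Finset.sum_card_bipartiteAbove_eq_sum_card_bipartiteBelow
      (s := S) (t := (Finset.univ : Finset (N → Fin (2 ^ M)))) fun z f => HasMargin δ ρ (a z) f
    simp only [Finset.bipartiteAbove, Finset.bipartiteBelow] at h2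
    rw [h2, Finset.mul_sum, mul_comm, ← Finset.card_univ, ← smul_eq_mul,
      ← Finset.sum_const] at h1
    obtain ⟨f, _, hf⟩ := Finset.exists_le_of_sum_le Finset.univ_nonempty h1
    exact ⟨f, hf⟩
  let Cl : N → Set V := fun t =>
    {v | v ∈ Y ∧ ∀ t', t' ≠ t → shifted δ (a v) f t' < shifted δ (a v) f t}
  have hCl : ∀ t, ∀ v ∈ Cl t, Reach w G (Cl t) (3 * (M * δ)) v t := by
    rintro t v ⟨hvY, hv⟩
    have hat : a v t ≤ 3 * (M * δ) := by
      obtain ⟨t', ht'⟩ := hclose v hvY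
      have ht' : a v t' ≤ 2 * (M * δ) := ht'
      by_cases htt : t' = t
      · subst htt; linarith
      · have h1 := hv t' htt
        have h2 : (geomLevel (f t) : ℝ) * δ ≤ M * δ := by
          gcongr; exact geomLevel_le _
        have h3 : 0 ≤ (geomLevel (f t') : ℝ) * δ := by positivity
        simp only [shifted] at h1
        linarith
    obtain ⟨p, hp, hmin⟩ := exists_min_walk hw (hreach v hvY t)
    have hpw : walkWeight w p ≤ a v t := hmin _ (hreach v hvY t)
    refine ⟨p, fun x hx => ⟨hp x hx, fun t' htt => ?_⟩, hpw.trans hat⟩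
    obtain ⟨l, l', hl, h1, h2⟩ := exists_reach_of_mem_support (w := w) hp hx
    have h3 : a x t ≤ l' := distIn_le hw h2
    have h4 := htri h1 t'
    have h5 := hv t' htt
    have h6 : walkWeight w p ≤ a v t := hpw
    have h7 : a v t ≤ walkWeight w p := distIn_le hw ⟨p, hp, le_rfl⟩
    have h8 : a v t ≤ l + l' := by linarith
    have h9 : l + l' ≤ a v t := by linarith
    simp only [shifted] at h5 ⊢
    linarith
  refine ⟨Set.range Cl, ?_, ?_, S.filter fun z => HasMargin δ ρ (a z) f, Finset.filter_subset _ _, ?_, ?_⟩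
  · rintro _ ⟨t, rfl⟩
    refine ⟨fun v hv => hv.1, stronglyBounded_of_reach fun u hu v hv => ?_⟩
    exact ((hCl t u hu).trans (hCl t v hv).symm).mono subset_rfl (by linarith)
  · rintro _ ⟨t, rfl⟩ _ ⟨t', rfl⟩ hne
    refine Set.disjoint_left.2 fun v hv hv' => ?_
    have htt : t ≠ t' := fun h => hne (h ▸ rfl)
    exact lt_asymm (hv.2 t' htt.symm) (hv'.2 t htt)
  · intro z hz
    obtain ⟨hzS, t, ht⟩ := Finset.mem_filter.1 hz
    refine ⟨Cl t, ⟨t, rfl⟩, fun u hu => ?_⟩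
    have hzu := (hS z hzS).reach hw hu
    refine ⟨hzu.right_mem, fun t' htt => ?_⟩
    have h1 := ht t' htt
    have h2 := htri hzu t'
    have h3 := htri hzu.symm t
    simp only [shifted] at h1 ⊢
    linarith
  · have : (S.card : ℝ) ≤ 4 * ((S.filter fun z => HasMargin δ ρ (a z) f).card : ℝ) := by exact_mod_cast hf
    linarith

end Families

section Averaging

variable {M : ℕ}

/-- The law of a geometric variable truncated to `{1, …, M}`. -/
noncomputable def truncGeom (M k : ℕ) : ℝ := (1 / 2) ^ min k (M - 1)

theorem truncGeom_nonneg (k : ℕ) : 0 ≤ truncGeom M k := by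
  unfold truncGeom; positivity

theorem half_pow_le_truncGeom (k : ℕ) : (1 / 2 : ℝ) ^ k ≤ truncGeom M k :=
  pow_le_pow_of_le_one (by norm_num) (by norm_num) (min_le_left _ _)

theorem sum_Ico_half_pow {m : ℕ} (hm : 1 ≤ m) :
    ∑ k ∈ Finset.Ico 1 m, (1 / 2 : ℝ) ^ k = 1 - 2 * (1 / 2) ^ m := by
  induction m, hm using Nat.le_induction with
  | base => norm_num
  | succ m hm ih =>
    rw [Finset.sum_Ico_succ_top hm, ih, pow_succ]
    ring

theorem sum_truncGeom_lt {m : ℕ} (hm : 1 ≤ m) (hmM : m ≤ M) :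
    ∑ k ∈ (Finset.Icc 1 M).filter (· < m), truncGeom M k = 1 - 2 * (1 / 2) ^ m := by
  rw [← sum_Ico_half_pow hm]
  refine Finset.sum_congr ?_ fun k hk => ?_
  · ext k
    simp only [Finset.mem_filter, Finset.mem_Icc, Finset.mem_Ico]
    omega
  · rw [truncGeom, min_eq_left]
    have := Finset.mem_Ico.1 hk
    omega

theorem sum_truncGeom (hM : 1 ≤ M) : ∑ k ∈ Finset.Icc 1 M, truncGeom M k = 1 := by
  have h := sum_truncGeom_lt hM le_rfl
  have h1 : (Finset.Icc 1 M).filter (· < M) = Finset.Ico 1 M := by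
    ext k
    simp only [Finset.mem_filter, Finset.mem_Icc, Finset.mem_Ico]
    omega
  rw [h1] at h
  rw [← Finset.Ico_insert_right hM, Finset.sum_insert (by simp), h, truncGeom,
    min_eq_right (Nat.sub_le _ _)]
  obtain ⟨m, rfl⟩ := Nat.exists_eq_add_of_le' hM
  simp only [Nat.add_sub_cancel, pow_succ]
  ring

theorem sum_truncGeom_lt_of_lt (hM : 1 ≤ M) {m : ℕ} (hm : M < m) :
    ∑ k ∈ (Finset.Icc 1 M).filter (· < m), truncGeom M k = 1 := by
  rw [Finset.filter_true_of_mem, sum_truncGeom hM]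
  intro k hk
  exact (Finset.mem_Icc.1 hk).2.trans_lt hm

theorem le_sum_truncGeom_lt (hM : 1 ≤ M) (m : ℕ) :
    1 - 2 * (1 / 2 : ℝ) ^ m ≤ ∑ k ∈ (Finset.Icc 1 M).filter (· < m), truncGeom M k := by
  rcases Nat.eq_zero_or_pos m with rfl | hm
  · norm_num
  · rcases le_or_gt m M with h | h
    · exact (sum_truncGeom_lt hm h).ge
    · rw [sum_truncGeom_lt_of_lt hM h]
      have : (0 : ℝ) ≤ (1 / 2) ^ m := by positivity
      linarith

theorem half_pow_mul_sum_truncGeom_ge (hM : 1 ≤ M) (h l : ℕ) :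
    (1 / 2 : ℝ) ^ l - 2 * (1 / 2) ^ h ≤
      (1 / 2) ^ l * ∑ k ∈ (Finset.Icc 1 M).filter (· < h - l), truncGeom M k := by
  have h0 := le_sum_truncGeom_lt hM (h - l)
  have hl : (0 : ℝ) < (1 / 2) ^ l := by positivity
  rcases le_total l h with hlh | hlh
  · have h1 : (1 / 2 : ℝ) ^ h = (1 / 2) ^ l * (1 / 2) ^ (h - l) := by
      rw [← pow_add]; congr 1; omega
    rw [h1]
    nlinarith
  · have h1 : (1 / 2 : ℝ) ^ l ≤ (1 / 2) ^ h :=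
      pow_le_pow_of_le_one (by norm_num) (by norm_num) hlh
    have h2 : (0 : ℝ) < (1 / 2) ^ h := by positivity
    have h3 : 0 ≤ ∑ k ∈ (Finset.Icc 1 M).filter (· < h - l), truncGeom M k :=
      Finset.sum_nonneg fun _ _ => truncGeom_nonneg _
    nlinarith

theorem le_sum_truncGeom_mul (h : ℕ) :
    (min (h - 1) M : ℕ) * (1 / 2 : ℝ) ^ h ≤
      ∑ k ∈ (Finset.Icc 1 M).filter (· < h), truncGeom M k * (1 / 2) ^ (h - k) := by
  have hcard : ((Finset.Icc 1 M).filter (· < h)).card = min (h - 1) M := by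
    have : (Finset.Icc 1 M).filter (· < h) = Finset.Icc 1 (min (h - 1) M) := by
      ext k
      simp only [Finset.mem_filter, Finset.mem_Icc]
      omega
    rw [this, Nat.card_Icc]
    omega
  rw [← hcard, ← nsmul_eq_mul, ← Finset.sum_const]
  refine Finset.sum_le_sum fun k hk => ?_
  have hk := (Finset.mem_filter.1 hk).2
  have h1 : (1 / 2 : ℝ) ^ h = (1 / 2) ^ k * (1 / 2) ^ (h - k) := by
    rw [← pow_add]; congr 1; omega
  rw [h1]
  gcongr
  exact half_pow_le_truncGeom k

theorem sum_truncGeom_gt (hM : 1 ≤ M) (h : ℕ) :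
    ∑ k ∈ (Finset.Icc 1 M).filter (h < ·), truncGeom M k = if h < M then (1 / 2) ^ h else 0 := by
  split_ifs with hh
  · have h1 := sum_truncGeom_lt (M := M) (m := h + 1) (by omega) hh
    have h2 := Finset.sum_filter_add_sum_filter_not (Finset.Icc 1 M) (· < h + 1) (truncGeom M)
    rw [h1, sum_truncGeom hM] at h2
    have h3 : (Finset.Icc 1 M).filter (fun k => ¬ k < h + 1) =
        (Finset.Icc 1 M).filter (h < ·) :=
      Finset.filter_congr fun k _ => by omega
    rw [h3, pow_succ] at h2
    linarith
  · rw [Finset.filter_false_of_mem, Finset.sum_empty]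
    intro k hk
    exact fun hhk => hh (hhk.trans_le (Finset.mem_Icc.1 hk).2)

theorem truncGeom_potential_ineq {r : ℕ} (hr : 1 ≤ r) (h : ℕ) :
    1 / 4 + 1 / (4 * r) * (2 * (r - 1) * (1 / 2 : ℝ) ^ h) ≤
      ∑ k ∈ (Finset.Icc 1 (4 * r)).filter (h < ·), truncGeom (4 * r) k +
      1 / 4 * ∑ k ∈ (Finset.Icc 1 (4 * r)).filter (· < h), truncGeom (4 * r) k +
      1 / (4 * r) * ∑ k ∈ (Finset.Icc 1 (4 * r)).filter (· < h),
        truncGeom (4 * r) k * (1 / 2) ^ (h - k) := by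
  have hr' : (1 : ℝ) ≤ r := by exact_mod_cast hr
  have hb : (0 : ℝ) < 1 / (4 * r) := by positivity
  have hbr : 1 / (4 * (r : ℝ)) * r = 1 / 4 := by field_simp
  set b : ℝ := 1 / (4 * r)
  have he : (0 : ℝ) < (1 / 2) ^ h := by positivity
  have hE := le_sum_truncGeom_mul (M := 4 * r) h
  rw [sum_truncGeom_gt (by omega)]
  set E := ∑ k ∈ (Finset.Icc 1 (4 * r)).filter (· < h),
        truncGeom (4 * r) k * (1 / 2 : ℝ) ^ (h - k)
  have hE0 : 0 ≤ E := le_trans (by positivity) hE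
  have hbE : 0 ≤ b * E := by positivity
  have key : b * (2 * (r - 1) * (1 / 2 : ℝ) ^ h) = (1 / 2 - 2 * b) * (1 / 2) ^ h := by
    linear_combination 2 * (1 / 2 : ℝ) ^ h * hbr
  rw [key]
  have hbe : 0 < b * (1 / 2 : ℝ) ^ h := by positivity
  rcases Nat.eq_zero_or_pos h with rfl | hpos
  · rw [if_pos (by omega)]
    have : 0 ≤ ∑ k ∈ (Finset.Icc 1 (4 * r)).filter (· < 0), truncGeom (4 * r) k :=
      Finset.sum_nonneg fun _ _ => truncGeom_nonneg _
    simp only [pow_zero] at *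
    linarith
  rcases lt_trichotomy h (4 * r) with hh | hh | hh
  · rw [if_pos hh, sum_truncGeom_lt hpos hh.le]
    linarith
  · rw [if_neg (by omega), sum_truncGeom_lt hpos hh.le]
    have h1 : ((min (h - 1) (4 * r) : ℕ) : ℝ) = 4 * r - 1 := by
      rw [min_eq_left (by omega), Nat.cast_sub hpos, hh]; push_cast; ring
    rw [h1] at hE
    have h2 := mul_le_mul_of_nonneg_left hE hb.le
    have h3 : b * ((4 * r - 1) * (1 / 2 : ℝ) ^ h) = (1 - b) * (1 / 2) ^ h := by
      linear_combination 4 * (1 / 2 : ℝ) ^ h * hbr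
    linarith
  · rw [if_neg (by omega), sum_truncGeom_lt_of_lt (by omega) hh]
    have h1 : ((min (h - 1) (4 * r) : ℕ) : ℝ) = 4 * r := by
      rw [min_eq_right (by omega)]; push_cast; ring
    rw [h1] at hE
    have h2 := mul_le_mul_of_nonneg_left hE hb.le
    have h3 : b * ((4 * r) * (1 / 2 : ℝ) ^ h) = (1 / 2) ^ h := by
      linear_combination 4 * (1 / 2 : ℝ) ^ h * hbr
    linarith

/-- The potential of a vertex does not decrease in expectation. -/
theorem potential_le_sum_truncGeom {ι : Type*} {r : ℕ} (hr : 1 ≤ r) (K : Finset ι)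
    (hK : K.card + 1 ≤ r) (l : ι → ℕ) (h : ℕ) (v : ℕ → ℝ) (hv : ∀ k, 0 ≤ v k)
    (hgt : ∀ k, h < k → 1 ≤ v k)
    (hlt : ∀ k < h, 1 / 4 + 1 / (4 * r) * ((1 / 2 : ℝ) ^ (h - k) +
      ∑ X ∈ K.filter (fun X => l X < h - k), (1 / 2 : ℝ) ^ l X) ≤ v k) :
    1 / 4 + 1 / (4 * r) * ∑ X ∈ K, (1 / 2 : ℝ) ^ l X ≤
      ∑ k ∈ Finset.Icc 1 (4 * r), truncGeom (4 * r) k * v k := by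
  have hM : 1 ≤ 4 * r := by omega
  have hr' : (1 : ℝ) ≤ r := by exact_mod_cast hr
  have hb : (0 : ℝ) < 1 / (4 * r) := by positivity
  have hpot := truncGeom_potential_ineq hr h
  set b : ℝ := 1 / (4 * r)
  have hX : ∑ X ∈ K, (1 / 2 : ℝ) ^ l X - 2 * (r - 1) * (1 / 2) ^ h ≤
      ∑ X ∈ K, (1 / 2 : ℝ) ^ l X *
        ∑ k ∈ (Finset.Icc 1 (4 * r)).filter (· < h - l X), truncGeom (4 * r) k := by
    refine le_trans ?_ (Finset.sum_le_sum fun X _ => half_pow_mul_sum_truncGeom_ge hM h (l X))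
    rw [Finset.sum_sub_distrib, Finset.sum_const, nsmul_eq_mul]
    have h1 : (K.card : ℝ) ≤ r - 1 := by
      have : ((K.card + 1 : ℕ) : ℝ) ≤ r := by exact_mod_cast hK
      push_cast at this
      linarith
    have he : (0 : ℝ) < (1 / 2) ^ h := by positivity
    nlinarith
  have hsum : ∑ k ∈ Finset.Icc 1 (4 * r), ((if h < k then truncGeom (4 * r) k else 0) +
      1 / 4 * (if k < h then truncGeom (4 * r) k else 0) +
      b * (if k < h then truncGeom (4 * r) k * (1 / 2) ^ (h - k) else 0) +
      b * ∑ X ∈ K, (1 / 2 : ℝ) ^ l X * (if k < h - l X then truncGeom (4 * r) k else 0)) ≤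
      ∑ k ∈ Finset.Icc 1 (4 * r), truncGeom (4 * r) k * v k := by
    refine Finset.sum_le_sum fun k _ => ?_
    have hp := truncGeom_nonneg (M := 4 * r) k
    by_cases hk : k < h
    · have h1 := mul_le_mul_of_nonneg_left (hlt k hk) hp
      have h2 : ∑ X ∈ K, (1 / 2 : ℝ) ^ l X * (if k < h - l X then truncGeom (4 * r) k else 0) =
          truncGeom (4 * r) k *
            ∑ X ∈ K.filter (fun X => l X < h - k), (1 / 2 : ℝ) ^ l X := by
        rw [Finset.mul_sum, Finset.sum_filter]
        refine Finset.sum_congr rfl fun X _ => ?_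
        have : k < h - l X ↔ l X < h - k := by omega
        simp only [this]
        split_ifs <;> ring
      rw [h2, if_neg (by omega), if_pos hk, if_pos hk]
      refine le_trans (le_of_eq ?_) h1
      ring
    · have h2 : ∑ X ∈ K, (1 / 2 : ℝ) ^ l X *
          (if k < h - l X then truncGeom (4 * r) k else 0) = 0 := by
        refine Finset.sum_eq_zero fun X _ => ?_
        rw [if_neg (by omega), mul_zero]
      rw [h2, if_neg hk, if_neg hk]
      split_ifs with hk'
      · have := mul_le_mul_of_nonneg_left (hgt k hk') hp
        linarith
      · have := mul_nonneg hp (hv k)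
        linarith
  refine le_trans ?_ hsum
  simp only [Finset.sum_add_distrib, ← Finset.mul_sum, ← Finset.sum_filter]
  rw [Finset.sum_comm]
  simp only [← Finset.mul_sum, ← Finset.sum_filter]
  have := mul_le_mul_of_nonneg_left hX hb.le
  linarith

end Averaging

section Regions

variable {V : Type*} {w : Sym2 V → ℝ} {G : SimpleGraph V}
variable {A B C D T P X Y : Set V} {L L' l ρ δ : ℝ} {s t u v x z : V} {k : ℕ}

/-- A shortest walk inside `C` to a vertex of `P` gives a set along which the distance from the
start is an exact coordinate. -/
theorem exists_geodesic_set [Finite V] (hw : ∀ e, 0 ≤ w e) (hC : ConnIn w G C) (ht : t ∈ C)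
    (hP : x ∈ C) :
    ∃ Q ⊆ C, t ∈ Q ∧ x ∈ Q ∧
      ∀ u ∈ Q, ∀ v ∈ Q, Reach w G Q |distIn w G C t u - distIn w G C t v| u v := by
  obtain ⟨p, hp, hmin⟩ := exists_min_walk hw (hC.2 t ht x hP).choose_spec
  have hpp : ∀ y ∈ p.support, y ∈ {y | y ∈ p.support} := fun _ h => h
  have hsub : {y | y ∈ p.support} ⊆ C := hp
  have key : ∀ {u v : V} {a l b : ℝ}, Reach w G {y | y ∈ p.support} a t u →
      Reach w G {y | y ∈ p.support} l u v → Reach w G {y | y ∈ p.support} b v x →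
      a + l + b ≤ walkWeight w p → l ≤ distIn w G C t v - distIn w G C t u := by
    intro u v a l b h1 h2 h3 hle
    have hu := distIn_le hw (h1.mono hsub le_rfl)
    have hv : a + l ≤ distIn w G C t v := by
      refine le_distIn ((h1.trans h2).mono hsub le_rfl) fun L' hL' => ?_
      have := hmin _ (hL'.trans (h3.mono hsub le_rfl))
      linarith
    linarith
  refine ⟨{y | y ∈ p.support}, hsub, p.start_mem_support, p.end_mem_support, ?_⟩
  intro u hu v hv
  classical
  have hv' : v ∈ p.support := hv
  have hspec := p.take_spec hv'
  have hwt : walkWeight w (p.takeUntil v hv') + walkWeight w (p.dropUntil v hv') =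
      walkWeight w p := by rw [← walkWeight_append, hspec]
  have hu' : u ∈ (p.takeUntil v hv').support ∨ u ∈ (p.dropUntil v hv').support := by
    rw [← SimpleGraph.Walk.mem_support_append_iff, hspec]
    exact hu
  have htake : ∀ y ∈ (p.takeUntil v hv').support, y ∈ {y | y ∈ p.support} :=
    fun y hy => p.support_takeUntil_subset_support hv' hy
  have hdrop : ∀ y ∈ (p.dropUntil v hv').support, y ∈ {y | y ∈ p.support} :=
    fun y hy => p.support_dropUntil_subset_support hv' hy
  rcases hu' with h | h
  · obtain ⟨a, b, hab, h1, h2⟩ := exists_reach_of_mem_support (w := w) htake h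
    have := key h1 h2 ⟨_, hdrop, le_rfl⟩ (by linarith)
    refine h2.mono subset_rfl (this.trans ?_)
    rw [abs_sub_comm]
    exact le_abs_self _
  · obtain ⟨a, b, hab, h1, h2⟩ := exists_reach_of_mem_support (w := w) hdrop h
    have := key ⟨_, htake, le_rfl⟩ h1 h2 (by linarith)
    exact h1.symm.mono subset_rfl (this.trans (le_abs_self _))

theorem abs_distIn_sub_le [Finite V] (hw : ∀ e, 0 ≤ w e) (hC : ConnIn w G C) (ht : t ∈ C)
    (h : Reach w G C L u v) : |distIn w G C t u - distIn w G C t v| ≤ L := by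
  have hu := reach_distIn hw (hC.2 t ht u h.left_mem).choose_spec
  have hv := reach_distIn hw (hC.2 t ht v h.right_mem).choose_spec
  have h1 := distIn_le hw (hu.trans h)
  have h2 := distIn_le hw (hv.trans h.symm)
  rw [abs_le]
  constructor <;> linarith

/-- The vertices of `C` within distance `l` of `T`, measured inside `C`. -/
def nbhd (w : Sym2 V → ℝ) (G : SimpleGraph V) (C T : Set V) (l : ℝ) : Set V :=
  {u | ∃ t ∈ T, Reach w G C l u t}

theorem nbhd_subset : nbhd w G C T l ⊆ C := fun _ ⟨_, _, h⟩ => h.left_mem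

theorem subset_nbhd (hl : 0 ≤ l) (hT : T ⊆ C) : T ⊆ nbhd w G C T l :=
  fun t ht => ⟨t, ht, Reach.refl (hT ht) hl⟩

theorem exists_reach_of_mem_nbhd (hw : ∀ e, 0 ≤ w e) (hu : u ∈ nbhd w G C T l) :
    ∃ t ∈ T, Reach w G (nbhd w G C T l) l u t := by
  obtain ⟨t, ht, p, hp, hl⟩ := hu
  refine ⟨t, ht, p, fun x hx => ⟨t, ht, ?_⟩, hl⟩
  obtain ⟨a, b, hab, ha, hb⟩ := exists_reach_of_mem_support (w := w) hp hx
  exact hb.mono subset_rfl (by linarith [ha.nonneg hw])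

theorem connIn_nbhd (hw : ∀ e, 0 ≤ w e) (hl : 0 ≤ l) (hTC : T ⊆ C) (hT : ConnIn w G T) :
    ConnIn w G (nbhd w G C T l) := by
  refine ⟨hT.1.mono (subset_nbhd hl hTC), fun u hu v hv => ?_⟩
  obtain ⟨s, hs, hus⟩ := exists_reach_of_mem_nbhd hw hu
  obtain ⟨t, ht, hvt⟩ := exists_reach_of_mem_nbhd hw hv
  obtain ⟨L, hL⟩ := hT.2 s hs t ht
  exact ⟨_, (hus.trans (hL.mono (subset_nbhd hl hTC) le_rfl)).trans hvt.symm⟩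

/-- The connected component of `z` inside `A`. -/
def component (w : Sym2 V → ℝ) (G : SimpleGraph V) (A : Set V) (z : V) : Set V :=
  {u | ∃ L, Reach w G A L z u}

theorem component_subset : component w G A z ⊆ A := fun _ ⟨_, h⟩ => h.right_mem

theorem Reach.component (h : Reach w G A L u v) (hu : u ∈ component w G A z) :
    Reach w G (component w G A z) L u v := by
  obtain ⟨p, hp, hL⟩ := h
  obtain ⟨L', hL'⟩ := hu
  refine ⟨p, fun x hx => ?_, hL⟩
  obtain ⟨a, b, hab, ha, hb⟩ := exists_reach_of_mem_support (w := w) hp hx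
  exact ⟨_, hL'.trans ha⟩

theorem mem_component_self (hz : z ∈ A) : z ∈ component w G A z := ⟨0, Reach.refl hz le_rfl⟩

theorem connIn_component (hz : z ∈ A) : ConnIn w G (component w G A z) := by
  refine ⟨⟨z, mem_component_self hz⟩, fun u hu v hv => ?_⟩
  obtain ⟨L, hL⟩ := hu
  obtain ⟨L', hL'⟩ := hv
  exact ⟨_, (hL.symm.trans hL').component ⟨L, hL⟩⟩

theorem component_eq_of_mem (h : x ∈ component w G A u) (h' : x ∈ component w G A v) :
    component w G A u = component w G A v := by
  obtain ⟨L, hL⟩ := h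
  obtain ⟨L', hL'⟩ := h'
  ext y
  constructor
  · rintro ⟨l, hl⟩
    exact ⟨_, (hL'.trans hL.symm).trans hl⟩
  · rintro ⟨l, hl⟩
    exact ⟨_, (hL.trans hL'.symm).trans hl⟩

theorem Padded.component (hw : ∀ e, 0 ≤ w e) (h : Padded w G ρ z A) :
    Padded w G ρ z (component w G A z) := fun _ hu => ⟨_, h.reach hw hu⟩

/-- Some edge joins the two sets. -/
def Touches (G : SimpleGraph V) (X A : Set V) : Prop := ∃ u ∈ X, ∃ v ∈ A, G.Adj u v

theorem Touches.symm (h : Touches G X A) : Touches G A X := by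
  obtain ⟨u, hu, v, hv, huv⟩ := h
  exact ⟨v, hv, u, hu, huv.symm⟩

/-- The vertices of `C` adjacent to `X`. -/
def portals (G : SimpleGraph V) (C X : Set V) : Set V := {x | x ∈ C ∧ ∃ u ∈ X, G.Adj u x}

theorem Touches.portals_nonempty (h : Touches G X C) : (portals G C X).Nonempty := by
  obtain ⟨u, hu, v, hv, huv⟩ := h
  exact ⟨v, hv, u, hu, huv⟩

theorem touches_of_mem_portals (h : x ∈ portals G C X) (hx : x ∈ A) : Touches G X A := by
  obtain ⟨_, u, hu, hux⟩ := h
  exact ⟨u, hu, x, hx, hux⟩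

/-- The distance from `z` to `P` inside `C`, in multiples of `δ` and up to the padding radius. -/
noncomputable def level (w : Sym2 V → ℝ) (G : SimpleGraph V) (δ ρ : ℝ) (C P : Set V) (z : V) : ℕ :=
  sInf {k : ℕ | ∃ x ∈ P, Reach w G C (k * δ + ρ) z x}

theorem level_le (hx : x ∈ P) (h : Reach w G C (k * δ + ρ) z x) : level w G δ ρ C P z ≤ k :=
  Nat.sInf_le ⟨x, hx, h⟩

theorem exists_reach_level (hδ : 0 < δ) (hρ : 0 ≤ ρ) (hC : ConnIn w G C) (hP : P.Nonempty)
    (hPC : P ⊆ C) (hz : z ∈ C) :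
    ∃ x ∈ P, Reach w G C (level w G δ ρ C P z * δ + ρ) z x := by
  refine Nat.sInf_mem (s := {k : ℕ | ∃ x ∈ P, Reach w G C (k * δ + ρ) z x}) ?_
  obtain ⟨x, hx⟩ := hP
  obtain ⟨L, hL⟩ := hC.2 z hz x (hPC hx)
  obtain ⟨n, hn⟩ := exists_nat_ge (L / δ)
  refine ⟨n, x, hx, hL.mono subset_rfl ?_⟩
  rw [div_le_iff₀ hδ] at hn
  linarith

theorem padded_nbhd_of_level_lt (hw : ∀ e, 0 ≤ w e) (hδ : 2 * ρ < δ) (hρ : 0 ≤ ρ)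
    (hC : ConnIn w G C) (hT : T.Nonempty) (hTC : T ⊆ C) (hz : Padded w G ρ z C)
    (h : level w G δ ρ C T z < k) : Padded w G ρ z (nbhd w G C T (k * δ)) := by
  intro u hu
  obtain ⟨x, hx, hzx⟩ := exists_reach_level (δ := δ) (by linarith) hρ hC hT hTC (hz.mem hρ)
  refine ⟨x, hx, ((hz.reach hw hu).symm.trans hzx).mono subset_rfl ?_⟩
  have : ((level w G δ ρ C T z + 1 : ℕ) : ℝ) * δ ≤ k * δ := by
    have : 0 ≤ δ := by linarith
    gcongr
    exact_mod_cast h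
  push_cast at this
  linarith

theorem padded_diff_of_lt_level (hw : ∀ e, 0 ≤ w e) (hz : Padded w G ρ z C)
    (h : k < level w G δ ρ C T z) : Padded w G ρ z (C \ nbhd w G C T (k * δ)) := by
  intro u hu
  have hzu := hz.reach hw hu
  refine ⟨hzu.right_mem, ?_⟩
  rintro ⟨t, ht, hut⟩
  exact absurd (level_le ht ((hzu.trans hut).mono subset_rfl (add_comm _ _).le)) (not_le.2 h)

theorem exists_portal_nbhd (hδ : 0 < δ) (hρ : 0 ≤ ρ)
    (hC : ConnIn w G C) (hT : T.Nonempty) (hTC : T ⊆ C) (hz : z ∈ C \ nbhd w G C T (k * δ))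
    (h : k < level w G δ ρ C T z) :
    ∃ x ∈ portals G (component w G (C \ nbhd w G C T (k * δ)) z) (nbhd w G C T (k * δ)),
      Reach w G (component w G (C \ nbhd w G C T (k * δ)) z)
        ((level w G δ ρ C T z - k : ℕ) * δ + ρ) z x := by
  obtain ⟨t, ht, p, hp, hpl⟩ := exists_reach_level (δ := δ) hδ hρ hC hT hTC hz.1
  obtain ⟨x, y, hxy, hy, a, b, hab, ha, hb⟩ := exists_first_entrance (w := w) p hp hz.2
    (subset_nbhd (by positivity) hTC ht)
  refine ⟨x, ⟨⟨a, ha⟩, y, hy, hxy.symm⟩,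
    (ha.component (mem_component_self hz)).mono subset_rfl ?_⟩
  have hbk : k * δ < b := by
    by_contra! hle
    exact ha.right_mem.2 ⟨t, ht, hb.mono subset_rfl hle⟩
  rw [Nat.cast_sub h.le]
  linarith

theorem exists_portal_of_level_lt (hw : ∀ e, 0 ≤ w e) (hδ : 0 < δ) (hρ : 0 ≤ ρ)
    (hC : ConnIn w G C) (hz : z ∈ C \ nbhd w G C T (k * δ)) (hX : Touches G X C)
    (h : level w G δ ρ C (portals G C X) z < level w G δ ρ C T z - k) :
    ∃ x ∈ portals G (component w G (C \ nbhd w G C T (k * δ)) z) X,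
      Reach w G (component w G (C \ nbhd w G C T (k * δ)) z)
        (level w G δ ρ C (portals G C X) z * δ + ρ) z x := by
  obtain ⟨x, hx, p, hp, hpl⟩ := exists_reach_level (δ := δ) hδ hρ hC hX.portals_nonempty
    (fun _ h => h.1) hz.1
  have hp' : Reach w G (C \ nbhd w G C T (k * δ))
      (level w G δ ρ C (portals G C X) z * δ + ρ) z x := by
    refine ⟨p, fun y hy => ⟨hp y hy, ?_⟩, hpl⟩
    rintro ⟨t, ht, hyt⟩
    obtain ⟨a, b, hab, ha, hb⟩ := exists_reach_of_mem_support (w := w) hp hy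
    have hle := level_le (k := level w G δ ρ C (portals G C X) z + k) ht
      ((ha.trans hyt).mono (L' := ((level w G δ ρ C (portals G C X) z + k : ℕ) : ℝ) * δ + ρ)
        subset_rfl (by push_cast; linarith [hb.nonneg hw]))
    omega
  exact ⟨x, ⟨⟨_, hp'⟩, hx.2⟩, hp'.component (mem_component_self hz)⟩

end Regions

section Cops

variable {V : Type*} {w : Sym2 V → ℝ} {G : SimpleGraph V}
variable {C : Set V} {ρ δ : ℝ} {z : V} {r : ℕ} {K : Finset (Set V)}

/-- A connected region `C` together with a clique model `K` outside `C`, each branch set of which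
touches `C`. -/
structure CopState (w : Sym2 V → ℝ) (G : SimpleGraph V) (C : Set V) (K : Finset (Set V)) :
    Prop where
  conn : ConnIn w G C
  conn_mem : ∀ X ∈ K, ConnIn w G X
  disj : ∀ X ∈ K, Disjoint X C
  touch : ∀ X ∈ K, Touches G X C
  pair : ∀ X ∈ K, ∀ X' ∈ K, X ≠ X' → Disjoint X X' ∧ Touches G X X'

theorem CopState.card_lt (h : CopState w G C K) (hr : ¬ HasCliqueMinor G r) : K.card < r := by
  by_contra! hle
  apply hr
  let e : Fin r → K := fun i => K.equivFin.symm (Fin.castLE hle i)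
  have he : ∀ i j, i ≠ j → (e i : Set V) ≠ e j := fun i j hij heq =>
    hij (Fin.castLE_injective hle (K.equivFin.symm.injective (Subtype.ext heq)))
  exact ⟨fun i => e i, fun i => induce_connected_of_connIn (h.conn_mem _ (e i).2),
    fun i j hij => (h.pair _ (e i).2 _ (e j).2 (he i j hij)).1,
    fun i j hij => (h.pair _ (e i).2 _ (e j).2 (he i j hij)).2⟩

/-- The potential of a vertex: it is large when `z` is close to many branch sets. -/
noncomputable def potential (w : Sym2 V → ℝ) (G : SimpleGraph V) (δ ρ : ℝ) (r : ℕ) (C : Set V)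
    (K : Finset (Set V)) (z : V) : ℝ :=
  1 / 4 + 1 / (4 * r) * ∑ X ∈ K, (1 / 2 : ℝ) ^ level w G δ ρ C (portals G C X) z

theorem potential_nonneg : 0 ≤ potential w G δ ρ r C K z := by
  unfold potential; positivity

/-- A tree of few geodesics of `C` reaching every branch set. -/
theorem CopState.exists_skeleton [Finite V] (hw : ∀ e, 0 ≤ w e) (h : CopState w G C K) :
    ∃ (c : V → ℝ) (𝒬 : Finset (Set V)), 𝒬.card ≤ K.card + 1 ∧ (∀ Q ∈ 𝒬, Q ⊆ C) ∧
      (∀ u v L, Reach w G C L u v → |c u - c v| ≤ L) ∧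
      (∀ Q ∈ 𝒬, ∀ u ∈ Q, ∀ v ∈ Q, Reach w G Q |c u - c v| u v) ∧
      ConnIn w G {t | ∃ Q ∈ 𝒬, t ∈ Q} ∧
      ∀ X ∈ K, Touches G X {t | ∃ Q ∈ 𝒬, t ∈ Q} := by
  classical
  obtain ⟨t, ht⟩ := h.conn.1
  have hQ : ∀ X : Set V, ∃ Q : Set V, X ∈ K → Q ⊆ C ∧ t ∈ Q ∧ Touches G X Q ∧
      ∀ u ∈ Q, ∀ v ∈ Q, Reach w G Q |distIn w G C t u - distIn w G C t v| u v := by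
    intro X
    by_cases hX : X ∈ K
    · obtain ⟨x, hx⟩ := (h.touch X hX).portals_nonempty
      obtain ⟨Q, hQC, htQ, hxQ, hQ⟩ := exists_geodesic_set hw h.conn ht hx.1
      exact ⟨Q, fun _ => ⟨hQC, htQ, touches_of_mem_portals hx hxQ, hQ⟩⟩
    · exact ⟨∅, fun h => absurd h hX⟩
  choose Q hQ using hQ
  have htQ : ∀ R ∈ insert {t} (K.image Q), t ∈ R := by
    simp only [Finset.mem_insert, Finset.mem_image]
    rintro R (rfl | ⟨X, hX, rfl⟩)
    exacts [rfl, (hQ X hX).2.1]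
  have hgeo : ∀ R ∈ insert {t} (K.image Q), ∀ u ∈ R, ∀ v ∈ R,
      Reach w G R |distIn w G C t u - distIn w G C t v| u v := by
    simp only [Finset.mem_insert, Finset.mem_image]
    rintro R (rfl | ⟨X, hX, rfl⟩)
    · rintro u rfl v rfl
      exact Reach.refl rfl (abs_nonneg _)
    · exact (hQ X hX).2.2.2
  refine ⟨distIn w G C t, insert {t} (K.image Q), ?_, ?_, ?_, hgeo, ?_, ?_⟩
  · exact (Finset.card_insert_le _ _).trans (Nat.add_le_add_right Finset.card_image_le 1)
  · simp only [Finset.mem_insert, Finset.mem_image]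
    rintro R (rfl | ⟨X, hX, rfl⟩)
    exacts [Set.singleton_subset_iff.2 ht, (hQ X hX).1]
  · exact fun u v L huv => abs_distIn_sub_le hw h.conn ht huv
  · have hto : ∀ u ∈ {s | ∃ R ∈ insert {t} (K.image Q), s ∈ R}, ∃ L,
        Reach w G {s | ∃ R ∈ insert {t} (K.image Q), s ∈ R} L u t := by
      rintro u ⟨R, hR, hu⟩
      exact ⟨_, (hgeo R hR u hu t (htQ R hR)).mono (fun s hs => ⟨R, hR, hs⟩) le_rfl⟩
    refine ⟨⟨t, {t}, by simp, rfl⟩, fun u hu v hv => ?_⟩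
    obtain ⟨L, hL⟩ := hto u hu
    obtain ⟨L', hL'⟩ := hto v hv
    exact ⟨_, hL.trans hL'.symm⟩
  · intro X hX
    obtain ⟨u, hu, v, hv, huv⟩ := (hQ X hX).2.2.1
    exact ⟨u, hu, v,
      ⟨Q X, Finset.mem_insert_of_mem (Finset.mem_image_of_mem Q hX), hv⟩, huv⟩

open scoped Classical in
/-- Removing a region `Y` from `C` and passing to a component gives a smaller state. -/
theorem CopState.toComponent {Y : Set V} (h : CopState w G C K) (hYC : Y ⊆ C) (hY : ConnIn w G Y)
    (hT : ∀ X ∈ K, Touches G X Y) (hz : z ∈ C \ Y) :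
    CopState w G (component w G (C \ Y) z)
      ((insert Y K).filter fun X => Touches G X (component w G (C \ Y) z)) where
  conn := connIn_component hz
  conn_mem := by
    intro X hX
    rcases Finset.mem_insert.1 (Finset.mem_filter.1 hX).1 with rfl | hX
    exacts [hY, h.conn_mem X hX]
  disj := by
    intro X hX
    rcases Finset.mem_insert.1 (Finset.mem_filter.1 hX).1 with rfl | hX
    · exact Set.disjoint_left.2 fun x hx hx' => (component_subset hx').2 hx
    · exact (h.disj X hX).mono_right (component_subset.trans Set.sdiff_subset)
  touch := fun X hX => (Finset.mem_filter.1 hX).2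
  pair := by
    intro X hX X' hX' hne
    replace hX := (Finset.mem_filter.1 hX).1
    replace hX' := (Finset.mem_filter.1 hX').1
    rcases Finset.mem_insert.1 hX with rfl | hXK <;>
    rcases Finset.mem_insert.1 hX' with rfl | hXK'
    · exact absurd rfl hne
    · exact ⟨((h.disj X' hXK').mono_right hYC).symm, (hT X' hXK').symm⟩
    · exact ⟨(h.disj X hXK).mono_right hYC, hT X hXK⟩
    · exact h.pair X hXK X' hXK' hne

open scoped Classical in
theorem CopState.le_potential_component (hw : ∀ e, 0 ≤ w e) (hδ : 0 < δ) (hρ : 0 ≤ ρ)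
    (h : CopState w G C K) {T : Set V} (hT : T.Nonempty) (hTC : T ⊆ C) {k : ℕ}
    (hz : z ∈ C \ nbhd w G C T (k * δ)) (hk : k < level w G δ ρ C T z) :
    1 / 4 + 1 / (4 * r) * ((1 / 2 : ℝ) ^ (level w G δ ρ C T z - k) +
      ∑ X ∈ K.filter (fun X => level w G δ ρ C (portals G C X) z < level w G δ ρ C T z - k),
        (1 / 2 : ℝ) ^ level w G δ ρ C (portals G C X) z) ≤
    potential w G δ ρ r (component w G (C \ nbhd w G C T (k * δ)) z)
      ((insert (nbhd w G C T (k * δ)) K).filter fun X =>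
        Touches G X (component w G (C \ nbhd w G C T (k * δ)) z)) z := by
  obtain ⟨x, hx, hzx⟩ := exists_portal_nbhd hδ hρ h.conn hT hTC hz hk
  have hX := fun X (hXK : X ∈ K) => exists_portal_of_level_lt hw hδ hρ h.conn hz (h.touch X hXK)
  have hTY := subset_nbhd (w := w) (G := G) (l := k * δ) (by positivity) hTC
  set Y := nbhd w G C T (k * δ)
  set D := component w G (C \ Y) z
  have hYK : Y ∉ K := fun hYK =>
    Set.disjoint_left.1 (h.disj Y hYK) (hTY hT.some_mem) (hTC hT.some_mem)
  have hhalf : ∀ {m n : ℕ}, m ≤ n → (1 / 2 : ℝ) ^ n ≤ (1 / 2) ^ m := fun hmn =>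
    pow_le_pow_of_le_one (by norm_num) (by norm_num) hmn
  unfold potential
  gcongr
  have hYf : Y ∉ K.filter
      (fun X => level w G δ ρ C (portals G C X) z < level w G δ ρ C T z - k) :=
    fun hYf => hYK (Finset.mem_filter.1 hYf).1
  calc _ ≤ ∑ X ∈ insert Y (K.filter
        (fun X => level w G δ ρ C (portals G C X) z < level w G δ ρ C T z - k)),
        (1 / 2 : ℝ) ^ level w G δ ρ D (portals G D X) z := by
        rw [Finset.sum_insert hYf]
        refine add_le_add (hhalf (level_le hx hzx)) (Finset.sum_le_sum fun X hXf => ?_)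
        obtain ⟨hXK, hXl⟩ := Finset.mem_filter.1 hXf
        obtain ⟨y, hy, hzy⟩ := hX X hXK hXl
        exact hhalf (level_le hy hzy)
    _ ≤ _ := by
        refine Finset.sum_le_sum_of_subset_of_nonneg (fun X hXi => ?_) fun _ _ _ => by positivity
        rcases Finset.mem_insert.1 hXi with rfl | hXf
        · exact Finset.mem_filter.2 ⟨Finset.mem_insert_self _ _, touches_of_mem_portals hx hx.1⟩
        · obtain ⟨hXK, hXl⟩ := Finset.mem_filter.1 hXf
          obtain ⟨y, hy, hzy⟩ := hX X hXK hXl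
          exact Finset.mem_filter.2
            ⟨Finset.mem_insert_of_mem hXK, touches_of_mem_portals hy hy.1⟩

open scoped Classical in
/-- One round of the game with a skeleton `T` of `C` and the region `Y` of radius `k * δ`: the
vertices deep inside `Y` are handled by `Y` itself, those away from `Y` by the components of
`C \ Y`. -/
theorem CopState.hasPaddedFamily_step [Finite V] {Δ : ℝ} (hw : ∀ e, 0 ≤ w e) (hδ : 2 * ρ < δ)
    (hρ : 0 ≤ ρ) (h : CopState w G C K) {T : Set V} (hT : ConnIn w G T) (hTC : T ⊆ C)
    (hTK : ∀ X ∈ K, Touches G X T) (k : ℕ) {S : Finset V} (hS : ∀ z ∈ S, Padded w G ρ z C)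
    (hY : ∀ S' : Finset V, (∀ z ∈ S', Padded w G ρ z (nbhd w G C T (k * δ))) →
      HasPaddedFamily w G ρ Δ (nbhd w G C T (k * δ)) S' (S'.card / 4))
    (ih : ∀ D ⊂ C, ∀ (K' : Finset (Set V)) (S' : Finset V), CopState w G D K' →
      (∀ z ∈ S', Padded w G ρ z D) →
      HasPaddedFamily w G ρ Δ D S' (1 / 4 * ∑ z ∈ S', potential w G δ ρ r D K' z)) :
    HasPaddedFamily w G ρ Δ C S (1 / 4 * ∑ z ∈ S,
      if level w G δ ρ C T z < k then 1 else if k < level w G δ ρ C T z then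
        potential w G δ ρ r (component w G (C \ nbhd w G C T (k * δ)) z)
          ((insert (nbhd w G C T (k * δ)) K).filter fun X =>
            Touches G X (component w G (C \ nbhd w G C T (k * δ)) z)) z else 0) := by
  have hδ0 : 0 < δ := by linarith
  have hYconn : ConnIn w G (nbhd w G C T (k * δ)) := connIn_nbhd hw (by positivity) hTC hT
  have hTY := subset_nbhd (w := w) (G := G) (l := k * δ) (by positivity) hTC
  have hdeep : ∀ z ∈ S, level w G δ ρ C T z < k → Padded w G ρ z (nbhd w G C T (k * δ)) :=
    fun z hz hk => padded_nbhd_of_level_lt hw hδ hρ h.conn hT.1 hTC (hS z hz) hk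
  have hfar : ∀ z ∈ S, k < level w G δ ρ C T z →
      Padded w G ρ z (C \ nbhd w G C T (k * δ)) :=
    fun z hz hk => padded_diff_of_lt_level hw (hS z hz) hk
  have hYC : nbhd w G C T (k * δ) ⊆ C := nbhd_subset
  have hTKY : ∀ X ∈ K, Touches G X (nbhd w G C T (k * δ)) := by
    intro X hX
    obtain ⟨u, hu, v, hv, huv⟩ := hTK X hX
    exact ⟨u, hu, v, hTY hv, huv⟩
  set Y := nbhd w G C T (k * δ)
  let D : V → Set V := component w G (C \ Y)
  let K' : Set V → Finset (Set V) := fun A => (insert Y K).filter fun X => Touches G X A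
  let Sin := S.filter fun z => level w G δ ρ C T z < k
  let Sout := S.filter fun z => k < level w G δ ρ C T z
  have hSout : ∀ z ∈ Sout, Padded w G ρ z (C \ Y) := fun z hz =>
    hfar z (Finset.mem_filter.1 hz).1 (Finset.mem_filter.1 hz).2
  have hfam := HasPaddedFamily.biUnion (w := w) (G := G) (Δ := Δ) (C := C) (S := S) hρ
    (Finset.insertNone (Sout.image D)) (P := fun o => o.elim Y id)
    (T := fun o => o.elim Sin fun A => Sout.filter fun z => D z = A)
    (q := fun o => o.elim ((Sin.card : ℝ) / 4) fun A =>
      1 / 4 * ∑ z ∈ Sout.filter (fun z => D z = A), potential w G δ ρ r A (K' A) z)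
    ?_ ?_ ?_ ?_
  · refine hfam.mono (le_of_eq ?_)
    rw [Finset.sum_insertNone]
    simp only [Option.elim]
    rw [← Finset.mul_sum]
    have h1 : ∑ A ∈ Sout.image D, ∑ z ∈ Sout.filter (fun z => D z = A),
        potential w G δ ρ r A (K' A) z = ∑ z ∈ Sout, potential w G δ ρ r (D z) (K' (D z)) z := by
      rw [← Finset.sum_fiberwise_of_maps_to (g := D) (t := Sout.image D)
        (fun z hz => Finset.mem_image_of_mem D hz)]
      refine Finset.sum_congr rfl fun A _ => Finset.sum_congr rfl fun z hz => ?_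
      rw [(Finset.mem_filter.1 hz).2]
    have h2 : (Sin.card : ℝ) = ∑ z ∈ S, if level w G δ ρ C T z < k then (1 : ℝ) else 0 := by
      rw [Finset.sum_ite, Finset.sum_const, Finset.sum_const_zero]
      simp [Sin]
    rw [h1, h2, Finset.sum_filter, div_eq_mul_one_div (Finset.sum _ _), mul_comm (Finset.sum _ _),
      ← mul_add, ← Finset.sum_add_distrib]
    congr 1
    refine Finset.sum_congr rfl fun z _ => ?_
    by_cases hz : level w G δ ρ C T z < k
    · rw [if_pos hz, if_pos hz, if_neg (by omega), add_zero]
    · rw [if_neg hz, if_neg hz, zero_add]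
  · rintro (_ | A) hA (_ | B) hB hne
    · exact absurd rfl hne
    · obtain ⟨z, _, rfl⟩ := Finset.mem_image.1 (Finset.some_mem_insertNone.1 hB)
      exact Set.disjoint_left.2 fun x hx hx' => (component_subset hx').2 hx
    · obtain ⟨z, _, rfl⟩ := Finset.mem_image.1 (Finset.some_mem_insertNone.1 hA)
      exact Set.disjoint_left.2 fun x hx hx' => (component_subset hx).2 hx'
    · obtain ⟨z, _, rfl⟩ := Finset.mem_image.1 (Finset.some_mem_insertNone.1 hA)
      obtain ⟨z', _, rfl⟩ := Finset.mem_image.1 (Finset.some_mem_insertNone.1 hB)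
      refine Set.disjoint_left.2 fun x hx hx' => hne ?_
      exact congrArg some (component_eq_of_mem hx hx')
  · rintro (_ | A) hA
    · exact hYC
    · obtain ⟨z, _, rfl⟩ := Finset.mem_image.1 (Finset.some_mem_insertNone.1 hA)
      exact component_subset.trans Set.sdiff_subset
  · rintro (_ | A) _
    · exact Finset.filter_subset _ _
    · exact (Finset.filter_subset _ _).trans (Finset.filter_subset _ _)
  · rintro (_ | A) hA
    · exact hY Sin fun z hz => hdeep z (Finset.mem_filter.1 hz).1 (Finset.mem_filter.1 hz).2
    · obtain ⟨z, hz, rfl⟩ := Finset.mem_image.1 (Finset.some_mem_insertNone.1 hA)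
      have hzm : z ∈ C \ Y := (hSout z hz).mem hρ
      refine ih (D z) ?_ (K' (D z)) _ (h.toComponent hYC hYconn hTKY hzm) fun z' hz' => ?_
      · obtain ⟨t, ht⟩ := hT.1
        refine Set.ssubset_iff_of_subset (component_subset.trans Set.sdiff_subset) |>.2
          ⟨t, hTC ht, fun htD => (component_subset htD).2 (hTY ht)⟩
      · obtain ⟨hz', hDz⟩ := Finset.mem_filter.1 hz'
        rw [← hDz]
        exact (hSout z' hz').component hw

theorem CopState.hasPaddedFamily [Finite V] (hw : ∀ e, 0 ≤ w e) (hδ : 2 * ρ < δ)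
    (hρ : 0 ≤ ρ) (hr : 1 ≤ r) (hminor : ¬ HasCliqueMinor G r) (h : CopState w G C K)
    {S : Finset V} (hS : ∀ z ∈ S, Padded w G ρ z C) :
    HasPaddedFamily w G ρ (6 * ((4 * r : ℕ) * δ)) C S
      (1 / 4 * ∑ z ∈ S, potential w G δ ρ r C K z) := by
  classical
  induction C using WellFoundedLT.induction generalizing K S with
  | ind C ih =>
  have hδ0 : 0 < δ := by linarith
  obtain ⟨c, 𝒬, h𝒬, h𝒬C, hc, hgeo, hT, hTK⟩ := h.exists_skeleton hw
  set T : Set V := {t | ∃ Q ∈ 𝒬, t ∈ Q}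
  have hTC : T ⊆ C := fun t ⟨Q, hQ, ht⟩ => h𝒬C Q hQ ht
  have hKr : K.card + 1 ≤ r := h.card_lt hminor
  have hpow : 14 * 𝒬.card ≤ 2 ^ (4 * r) := by
    have h1 : r < 2 ^ r := Nat.lt_two_pow_self
    have h2 : 2 ≤ 2 ^ r := by
      calc 2 = 2 ^ 1 := rfl
        _ ≤ 2 ^ r := Nat.pow_le_pow_right (by norm_num) hr
    have h3 : 2 ^ (4 * r) = 2 ^ r * (2 ^ r * (2 ^ r * 2 ^ r)) := by ring
    have h4 : 2 * (2 * 2) ≤ 2 ^ r * (2 ^ r * 2 ^ r) := by gcongr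
    have h5 : 𝒬.card + 1 ≤ 2 ^ r := by omega
    rw [h3]
    nlinarith
  let v : V → ℕ → ℝ := fun z k =>
    if level w G δ ρ C T z < k then 1 else if k < level w G δ ρ C T z then
        potential w G δ ρ r (component w G (C \ nbhd w G C T (k * δ)) z)
          ((insert (nbhd w G C T (k * δ)) K).filter fun X =>
            Touches G X (component w G (C \ nbhd w G C T (k * δ)) z)) z else 0
  have hpot : ∀ z ∈ S, potential w G δ ρ r C K z ≤
      ∑ k ∈ Finset.Icc 1 (4 * r), truncGeom (4 * r) k * v z k := by
    intro z hz
    refine potential_le_sum_truncGeom hr K hKr _ (level w G δ ρ C T z) (v z) ?_ ?_ ?_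
    · intro k
      simp only [v]
      split_ifs
      exacts [zero_le_one, potential_nonneg, le_rfl]
    · intro k hk
      simp only [v, if_pos hk, le_refl]
    · intro k hk
      simp only [v, if_pos hk, if_neg (not_lt.2 hk.le)]
      exact h.le_potential_component hw hδ0 hρ hT.1 hTC
        ((padded_diff_of_lt_level hw (hS z hz) hk).mem hρ) hk
  obtain ⟨k, hk, hle⟩ : ∃ k ∈ Finset.Icc 1 (4 * r),
      ∑ z ∈ S, potential w G δ ρ r C K z ≤ ∑ z ∈ S, v z k := by
    have h1 := Finset.sum_le_sum hpot
    rw [Finset.sum_comm] at h1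
    simp only [← Finset.mul_sum] at h1
    rw [← one_mul (∑ z ∈ S, potential w G δ ρ r C K z),
      ← sum_truncGeom (M := 4 * r) (by omega), Finset.sum_mul] at h1
    obtain ⟨k, hk, h2⟩ := Finset.exists_le_of_sum_le
      (Finset.nonempty_Icc.2 (by omega : 1 ≤ 4 * r)) h1
    refine ⟨k, hk, le_of_mul_le_mul_left h2 ?_⟩
    exact lt_of_lt_of_le (by positivity) (half_pow_le_truncGeom k)
  refine HasPaddedFamily.mono (h.hasPaddedFamily_step (r := r) hw hδ hρ hT hTC hTK k hS ?_ ?_)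
    (mul_le_mul_of_nonneg_left hle (by norm_num))
  · intro S' hS'
    have hTY := subset_nbhd (w := w) (G := G) (l := k * δ) (by positivity) hTC
    have h𝒬Y : ∀ Q ∈ 𝒬, Q ⊆ nbhd w G C T (k * δ) := fun Q hQ t ht => hTY ⟨Q, hQ, ht⟩
    refine hasPaddedFamily_of_dominated hw hρ hδ (by omega)
      (connIn_nbhd hw (by positivity) hTC hT) 𝒬 hpow h𝒬Y (c := c)
      (fun u v L huv => hc u v L (huv.mono nbhd_subset le_rfl))
      (fun Q hQ u hu u' hu' => (hgeo Q hQ u hu u' hu').mono (h𝒬Y Q hQ) le_rfl) ?_ hS'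
    intro y hy
    obtain ⟨t, ⟨Q, hQ, ht⟩, hyt⟩ := exists_reach_of_mem_nbhd hw hy
    refine ⟨Q, hQ, t, ht, hyt.mono subset_rfl ?_⟩
    gcongr
    exact (Finset.mem_Icc.1 hk).2
  · exact fun D hD K' S' hD' hS' => ih D hD hD' hS'

end Cops

section Cover

variable {V : Type*} {w : Sym2 V → ℝ} {G : SimpleGraph V} {ρ Δ : ℝ} {r : ℕ}

theorem hasPaddedFamily_univ [Finite V] [Nonempty V] (hw : ∀ e, 0 ≤ w e) (hG : G.Connected)
    (hr : 1 ≤ r) (hminor : ¬ HasCliqueMinor G r) (hΔ : 0 < Δ) (S : Finset V) :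
    HasPaddedFamily w G (Δ / (72 * r)) Δ Set.univ S (S.card / 16) := by
  have hr0 : (0 : ℝ) < r := by exact_mod_cast hr
  have hρ : 0 < Δ / (72 * r) := by positivity
  have hstate : CopState w G Set.univ ∅ := by
    refine ⟨⟨Set.univ_nonempty, fun u _ v _ => ?_⟩, by simp, by simp, by simp, by simp⟩
    obtain ⟨p⟩ := hG.preconnected u v
    exact ⟨_, p, fun _ _ => trivial, le_rfl⟩
  have h := hstate.hasPaddedFamily (δ := 3 * (Δ / (72 * r))) hw (by linarith) hρ.le hr hminor
    (S := S) fun z _ u _ => trivial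
  have hΔ' : 6 * ((4 * r : ℕ) * (3 * (Δ / (72 * r)))) = Δ := by
    push_cast
    field_simp
    norm_num
  rw [hΔ'] at h
  refine h.mono (le_of_eq ?_)
  simp only [potential, Finset.sum_empty, Finset.sum_const, nsmul_eq_mul]
  ring

/-- Iterating a construction padding a fixed fraction of the vertices. -/
theorem exists_rounds
    (h : ∀ S : Finset V, HasPaddedFamily w G ρ Δ Set.univ S (S.card / 16)) (n : ℕ)
    (S : Finset V) :
    ∃ F : Fin n → Set (Set V), (∀ i, ∀ A ∈ F i, StronglyBounded w G A Δ) ∧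
      (∀ i, (F i).PairwiseDisjoint id) ∧
      ∃ S' : Finset V, (S'.card : ℝ) ≤ (15 / 16) ^ n * S.card ∧
        ∀ z ∈ S, z ∈ S' ∨ ∃ i, ∃ A ∈ F i, Padded w G ρ z A := by
  classical
  induction n generalizing S with
  | zero => exact ⟨Fin.elim0, fun i => i.elim0, fun i => i.elim0, S, by simp, fun z hz => .inl hz⟩
  | succ n ih =>
    obtain ⟨F₀, hF₀, hd₀, S₀, hS₀, hp₀, hc₀⟩ := h S
    obtain ⟨F, hF, hd, S', hS', hp⟩ := ih (S \ S₀)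
    refine ⟨Fin.cons F₀ F, Fin.cases (fun A hA => (hF₀ A hA).2) hF, Fin.cases hd₀ hd, S', ?_, ?_⟩
    · refine hS'.trans ?_
      rw [pow_succ, mul_assoc]
      gcongr
      rw [Finset.cast_card_sdiff hS₀]
      linarith
    · intro z hz
      by_cases hz₀ : z ∈ S₀
      · exact .inr ⟨0, hp₀ z hz₀⟩
      · rcases hp z (Finset.mem_sdiff.2 ⟨hz, hz₀⟩) with h | ⟨i, hi⟩
        exacts [.inl h, .inr ⟨i.succ, hi⟩]

theorem exists_cover_of_rounds [Finite V] {n : ℕ} (F : Fin n → Set (Set V))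
    (hd : ∀ i, (F i).PairwiseDisjoint id) :
    ∃ (m : ℕ) (C : Fin m → Set V), (∀ j, ∃ i, C j ∈ F i) ∧ (∀ i, ∀ A ∈ F i, ∃ j, C j = A) ∧
      ∀ v, ({j | v ∈ C j} : Set (Fin m)).ncard ≤ n := by
  obtain ⟨m, ⟨e⟩⟩ := Finite.exists_equiv_fin (Σ i, F i)
  refine ⟨m, fun j => (e.symm j).2, fun j => ⟨_, (e.symm j).2.2⟩,
    fun i A hA => ⟨e ⟨i, A, hA⟩, by beta_reduce; rw [Equiv.symm_apply_apply]⟩, fun v => ?_⟩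
  have := Set.ncard_le_ncard_of_injOn (s := {j | v ∈ ((e.symm j).2 : Set V)})
    (t := (Set.univ : Set (Fin n))) (fun j => (e.symm j).1) (fun _ _ => trivial) ?_
  · simpa [Set.ncard_univ] using this
  · intro j hj j' hj' h
    apply e.symm.injective
    have hj : v ∈ ((e.symm j).2 : Set V) := hj
    have hj' : v ∈ ((e.symm j').2 : Set V) := hj'
    have h : (e.symm j).1 = (e.symm j').1 := h
    revert h hj hj'
    generalize e.symm j = a
    generalize e.symm j' = b
    intro hv hv' h
    obtain ⟨i, A, hA⟩ := a
    obtain ⟨i', B, hB⟩ := b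
    obtain rfl : i = i' := h
    have : A = B := by
      by_contra hne
      exact Set.disjoint_left.1 (hd i hA hB hne) hv hv'
    subst this
    rfl

theorem exists_round_number {N : ℕ} (hN : 2 ≤ N) :
    ∃ n : ℕ, (15 / 16 : ℝ) ^ n * N < 1 ∧ (n : ℝ) ≤ 72 * Real.log N := by
  have hN2 : (2 : ℝ) ≤ N := by exact_mod_cast hN
  have hlog : 1 / 2 ≤ Real.log N :=
    le_trans (by linarith [Real.log_two_gt_d9]) (Real.log_le_log (by norm_num) hN2)
  refine ⟨⌊16 * Real.log N⌋₊ + 1, ?_, ?_⟩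
  · have h1 := Nat.lt_floor_add_one (16 * Real.log N)
    set n := ⌊16 * Real.log N⌋₊ + 1 with hn
    have hn' : 16 * Real.log N < n := by rw [hn]; push_cast; exact h1
    have h2 : (15 / 16 : ℝ) ≤ Real.exp (-1 / 16) := by
      linarith [Real.add_one_le_exp (-1 / 16 : ℝ)]
    have h3 : (15 / 16 : ℝ) ^ n < (N : ℝ)⁻¹ := by
      calc (15 / 16 : ℝ) ^ n ≤ Real.exp (-1 / 16) ^ n := by gcongr
        _ = Real.exp (n * (-1 / 16)) := (Real.exp_nat_mul _ _).symm
        _ < Real.exp (-Real.log N) := Real.exp_lt_exp.2 (by linarith)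
        _ = (N : ℝ)⁻¹ := by rw [Real.exp_neg, Real.exp_log (by linarith)]
    rwa [← lt_div_iff₀ (by linarith), one_div]
  · have := Nat.floor_le (show 0 ≤ 16 * Real.log N by linarith)
    push_cast
    linarith

end Cover

end Pad

/-- `K_r`-minor-free `n`-vertex graphs (`n ≥ 2`) admit a strong
`(c·r, c·log n)`-sparse cover scheme, for a universal constant `c > 0`. -/
theorem minor_free_sparse_cover_scheme :
    ∃ c : ℝ, 0 < c ∧
      ∀ (V : Type) [Fintype V], ∀ (G : SimpleGraph V), G.Connected → 2 ≤ Fintype.card V →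
      ∀ w : Sym2 V → ℝ, (∀ e, 0 ≤ w e) →
      ∀ r : ℕ, 2 ≤ r → ¬ Pad.HasCliqueMinor G r →
      ∀ Δ : ℝ, 0 < Δ →
      ∃ (m : ℕ) (C : Fin m → Set V),
        (∀ i, Pad.StronglyBounded w G (C i) Δ) ∧
        (∀ v : V, ∃ i, Pad.ball w G v (Δ / (c * r)) ⊆ C i) ∧
        (∀ v : V, (({i | v ∈ C i} : Set (Fin m)).ncard : ℝ) ≤
          c * Real.log (Fintype.card V)) := by
  refine ⟨72, by norm_num, fun V _ G hG hV w hw r hr hminor Δ hΔ => ?_⟩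
  have : Nonempty V := hG.nonempty
  obtain ⟨n, hn, hlog⟩ := Pad.exists_round_number hV
  obtain ⟨F, hF, hd, S', hS', hp⟩ := Pad.exists_rounds
    (Pad.hasPaddedFamily_univ hw hG (by omega) hminor hΔ) n Finset.univ
  obtain ⟨m, C, hCF, hFC, hov⟩ := Pad.exists_cover_of_rounds F hd
  refine ⟨m, C, fun j => ?_, fun v => ?_, fun v => ?_⟩
  · obtain ⟨i, hi⟩ := hCF j
    exact hF i _ hi
  · have hempty : S' = ∅ := by
      rw [Finset.card_univ] at hS'
      have : (S'.card : ℝ) < 1 := hS'.trans_lt hn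
      exact Finset.card_eq_zero.1 (Nat.lt_one_iff.1 (by exact_mod_cast this))
    rcases hp v (Finset.mem_univ v) with h | ⟨i, A, hA, hvA⟩
    · simp [hempty] at h
    · obtain ⟨j, rfl⟩ := hFC i A hA
      exact ⟨j, hvA.ball_subset hw hG⟩
  · exact le_trans (by exact_mod_cast hov v) hlog
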